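/- arXiv:2203.10914 — 10 statements merged into one kernel-verified Lean document; each statement's English description precedes it below -/
import Mathlib

section
/- A point (x*,y*) ∈ X×Y is a local minimax point if and only if y* is a local maximizer of f(x*,·) over Y and there exists δ₀ > 0 such that x* is a local minimizer over X of the function φ_δ(x) := max_{y'∈Y, ‖y'−y*‖≤δ} f(x,y') for every δ ∈ (0,δ₀]. -/
open Filter Topology Set Metric Bornology RealInnerProductSpace Pointwise

noncomputable section

variable {E : Type*} [NormedAddCommGroup E] [NormedSpace ℝ E]
variable {F : Type*} [NormedAddCommGroup F] [NormedSpace ℝ F]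

/-- Global minimax point. -/
def IsGlobalMinimax (X : Set E) (Y : Set F) (f : E → F → ℝ) (xh : E) (yh : F) : Prop :=
  xh ∈ X ∧ yh ∈ Y ∧ (∀ y ∈ Y, f xh y ≤ f xh yh) ∧ ∀ x ∈ X, f xh yh ≤ sSup (f x '' Y)

/-- Local minimax point. -/
def IsLocalMinimax (X : Set E) (Y : Set F) (f : E → F → ℝ) (xh : E) (yh : F) : Prop :=
  xh ∈ X ∧ yh ∈ Y ∧ ∃ δ₀ > (0:ℝ), ∃ τ : ℝ → ℝ, (∀ δ > (0:ℝ), 0 < τ δ) ∧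
    Tendsto τ (𝓝[>] (0:ℝ)) (𝓝 0) ∧
    ∀ δ ∈ Ioc (0:ℝ) δ₀, ∀ x ∈ X, ∀ y ∈ Y, ‖x - xh‖ ≤ δ → ‖y - yh‖ ≤ δ →
      f xh y ≤ f xh yh ∧ f xh yh ≤ sSup (f x '' {y' ∈ Y | ‖y' - yh‖ ≤ τ δ})

/-- Sequential tangent cone. -/
def tangentConeSeq (Ω : Set E) (x : E) : Set E :=
  {w | ∃ (xk : ℕ → E) (tk : ℕ → ℝ), (∀ k, xk k ∈ Ω) ∧ Tendsto xk atTop (𝓝 x) ∧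
    (∀ k, 0 < tk k) ∧ Tendsto tk atTop (𝓝 0) ∧
    Tendsto (fun k => (tk k)⁻¹ • (xk k - x)) atTop (𝓝 w)}

/-- Cone of feasible directions T°. -/
def feasCone (Ω : Set E) (x : E) : Set E := {w | ∃ l : ℝ, 0 < l ∧ x + l • w ∈ Ω}

/-- First-order subderivative  dg(x)(v). -/
def dsub (g : E → ℝ) (x v : E) : EReal :=
  Filter.liminf (fun p : E × ℝ => (((g (x + p.2 • p.1) - g x) / p.2 : ℝ) : EReal))
    ((𝓝 v) ×ˢ (𝓝[>] (0:ℝ)))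

/-- Semidifferentiability at a point. -/
def SemidiffAt (g : E → ℝ) (x : E) : Prop :=
  ∀ v, ∃ L : EReal,
    Tendsto (fun p : E × ℝ => (((g (x + p.2 • p.1) - g x) / p.2 : ℝ) : EReal))
      ((𝓝 v) ×ˢ (𝓝[>] (0:ℝ))) (𝓝 L)

/-- Second-order difference quotient used in d²g(x)(w). -/
def quot2 (g : E → ℝ) (x w : E) (t : ℝ) : EReal :=
  ((2 / t ^ 2 : ℝ) : EReal) *
    (((g (x + t • w) - g x : ℝ) : EReal) - (t : EReal) * dsub g x w)

/-- Second-order subderivative d²g(x)(w). -/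
def dsub2 (g : E → ℝ) (x w : E) : EReal :=
  Filter.liminf (fun p : E × ℝ => quot2 g x p.1 p.2) ((𝓝 w) ×ˢ (𝓝[>] (0:ℝ)))

/-- Twice semidifferentiability at a point. -/
def TwiceSemidiffAt (g : E → ℝ) (x : E) : Prop :=
  SemidiffAt g x ∧ ∀ w, ∃ L : EReal,
    Tendsto (fun p : E × ℝ => quot2 g x p.1 p.2) ((𝓝 w) ×ˢ (𝓝[>] (0:ℝ))) (𝓝 L)

/-- Second-order subderivative d²g(x|v)(w), for an inner product space. -/
def dsub2v {H : Type*} [NormedAddCommGroup H] [InnerProductSpace ℝ H]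
    (g : H → ℝ) (x v w : H) : EReal :=
  Filter.liminf (fun p : H × ℝ =>
      (((g (x + p.2 • p.1) - g x - p.2 * ⟪v, p.1⟫) / (p.2 ^ 2 / 2) : ℝ) : EReal))
    ((𝓝 w) ×ˢ (𝓝[>] (0:ℝ)))

/-- Clarke generalized directional derivative g°(x; v). -/
def clarkeDir (g : E → ℝ) (x v : E) : EReal :=
  Filter.limsup (fun p : E × ℝ => (((g (p.1 + p.2 • v) - g p.1) / p.2 : ℝ) : EReal))
    ((𝓝 x) ×ˢ (𝓝[>] (0:ℝ)))

/-- Generalized second-order directional derivative g°°(x; v, v). -/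
def clarkeDir2 (g : E → ℝ) (x v : E) : EReal :=
  Filter.limsup (fun p : E × ℝ × ℝ =>
      (((g (p.1 + p.2.1 • v + p.2.2 • v) - g (p.1 + p.2.1 • v) - g (p.1 + p.2.2 • v) + g p.1)
          / (p.2.1 * p.2.2) : ℝ) : EReal))
    ((𝓝 x) ×ˢ ((𝓝[>] (0:ℝ)) ×ˢ (𝓝[>] (0:ℝ))))

/-- Clarke regularity at a point. -/
def ClarkeRegularAt (g : E → ℝ) (x : E) : Prop :=
  ∀ v, ∃ L : ℝ, Tendsto (fun t : ℝ => (g (x + t • v) - g x) / t) (𝓝[>] (0:ℝ)) (𝓝 L) ∧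
    clarkeDir g x v = (L : EReal)

/-- Normal cone to a convex set (inner product setting). -/
def normalCone {H : Type*} [NormedAddCommGroup H] [InnerProductSpace ℝ H]
    (Ω : Set H) (x : H) : Set H :=
  {v | ∀ ω ∈ Ω, ⟪v, ω - x⟫ ≤ 0}


/-- A relation that is antitone in its first argument, monotone in its second, and for which every
small `ε` admits some `η > 0` with `P η ε`, is witnessed by a modulus `τ` tending to `0`. -/
theorem exists_modulus {P : ℝ → ℝ → Prop} {d : ℝ} (hd : 0 < d)
    (hanti : ∀ {δ δ' ε}, δ ≤ δ' → P δ' ε → P δ ε)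
    (hmono : ∀ {δ ε ε'}, 0 < ε → ε ≤ ε' → P δ ε → P δ ε')
    (h : ∀ ε ∈ Ioc 0 d, ∃ η > 0, P η ε) :
    ∃ δ₀ > (0 : ℝ), ∃ τ : ℝ → ℝ, (∀ δ > (0 : ℝ), 0 < τ δ) ∧ Tendsto τ (𝓝[>] (0 : ℝ)) (𝓝 0) ∧
      ∀ δ ∈ Ioc (0 : ℝ) δ₀, P δ (τ δ) := by
  have hnn (δ : ℝ) : 0 ≤ sInf {ε | 0 < ε ∧ P δ ε} := Real.sInf_nonneg fun _ hε => hε.1.le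
  have hpos : ∀ δ > (0 : ℝ), 0 < sInf {ε | 0 < ε ∧ P δ ε} + δ := fun δ hδ => by
    linarith [hnn δ]
  obtain ⟨η, hη, hPη⟩ := h d ⟨hd, le_rfl⟩
  refine ⟨η, hη, fun δ => sInf {ε | 0 < ε ∧ P δ ε} + δ, hpos, ?_, ?_⟩
  · refine Metric.tendsto_nhds.2 fun r hr => ?_
    have hm : 0 < min d (r / 2) := lt_min hd (half_pos hr)
    obtain ⟨η', hη', hPη'⟩ := h _ ⟨hm, min_le_left d (r / 2)⟩
    filter_upwards [Ioo_mem_nhdsGT (lt_min hη' (half_pos hr))] with δ hδ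
    have hle : sInf {ε | 0 < ε ∧ P δ ε} ≤ min d (r / 2) :=
      csInf_le ⟨0, fun _ hε => hε.1.le⟩ ⟨hm, hanti (hδ.2.le.trans (min_le_left _ _)) hPη'⟩
    rw [Real.dist_0_eq_abs, abs_of_pos (hpos δ hδ.1)]
    linarith [min_le_right d (r / 2), hδ.2.trans_le (min_le_right η' (r / 2))]
  · intro δ hδ
    obtain ⟨ε, ⟨hε, hPε⟩, hlt⟩ := exists_lt_of_csInf_lt
      (show {ε | 0 < ε ∧ P δ ε}.Nonempty from ⟨d, hd, hanti hδ.2 hPη⟩)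
      (lt_add_of_pos_right _ hδ.1)
    exact hmono hε hlt.le hPε

theorem sSup_image_ball_mono {G : Type*} [SeminormedAddCommGroup G] {Y : Set G} {g : G → ℝ}
    {y₀ : G} (hg : BddAbove (g '' Y))
    (hy₀ : y₀ ∈ Y) {r s : ℝ} (hr : 0 ≤ r) (hrs : r ≤ s) :
    sSup (g '' {y ∈ Y | ‖y - y₀‖ ≤ r}) ≤ sSup (g '' {y ∈ Y | ‖y - y₀‖ ≤ s}) :=
  csSup_le_csSup (hg.mono (image_mono (sep_subset _ _)))
    ⟨g y₀, y₀, ⟨hy₀, by simpa using hr⟩, rfl⟩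
    (image_mono fun _ hy => ⟨hy.1, hy.2.trans hrs⟩)

theorem le_sSup_image_ball {G : Type*} [SeminormedAddCommGroup G] {Y : Set G} {g : G → ℝ}
    {y₀ : G} (hg : BddAbove (g '' Y))
    (hy₀ : y₀ ∈ Y) {r : ℝ} (hr : 0 ≤ r) : g y₀ ≤ sSup (g '' {y ∈ Y | ‖y - y₀‖ ≤ r}) :=
  le_csSup (hg.mono (image_mono (sep_subset _ _))) ⟨y₀, ⟨hy₀, by simpa using hr⟩, rfl⟩

/-- A property holds eventually in `𝓝[s] a` iff it holds on `s` within a closed ball. -/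
theorem eventually_nhdsWithin_iff_norm {G : Type*} [SeminormedAddCommGroup G] {s : Set G} {a : G}
    {p : G → Prop} :
    (∀ᶠ x in 𝓝[s] a, p x) ↔ ∃ r > (0 : ℝ), ∀ x ∈ s, ‖x - a‖ ≤ r → p x := by
  rw [(nhdsWithin_hasBasis nhds_basis_closedBall s).eventually_iff]
  simp only [mem_inter_iff, mem_closedBall, dist_eq_norm]
  exact exists_congr fun r => and_congr_right fun _ =>
    ⟨fun h x hx hr => h ⟨hr, hx⟩, fun h x hx => h x hx.2 hx.1⟩

theorem isLocalMinimax_iff {X : Set E} {Y : Set F} {f : E → F → ℝ} {xs : E} {ys : F}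
    (henv : ∀ x ∈ X, BddAbove (f x '' Y)) (hxs : xs ∈ X) (hys : ys ∈ Y) :
    IsLocalMinimax X Y f xs ys ↔
      (IsLocalMaxOn (f xs) Y ys ∧
        ∃ δ₀ > (0:ℝ), ∀ δ ∈ Ioc (0:ℝ) δ₀,
          IsLocalMinOn (fun x => sSup (f x '' {y' ∈ Y | ‖y' - ys‖ ≤ δ})) X xs) := by
  constructor
  · rintro ⟨-, -, δ₀, hδ₀, τ, hτ, hlim, H⟩
    have hmax : ∀ y ∈ Y, ‖y - ys‖ ≤ δ₀ → f xs y ≤ f xs ys := fun y hy hyr =>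
      (H δ₀ ⟨hδ₀, le_rfl⟩ xs hxs y hy (by simpa using hδ₀.le) hyr).1
    refine ⟨eventually_nhdsWithin_iff_norm.2 ⟨δ₀, hδ₀, hmax⟩, δ₀, hδ₀, fun r hr => ?_⟩
    obtain ⟨δ, hδ, hτδ⟩ :=
      (Filter.Eventually.and (Ioc_mem_nhdsGT hδ₀) (hlim.eventually_lt_const hr.1)).exists
    refine eventually_nhdsWithin_iff_norm.2 ⟨δ, hδ.1, fun x hx hxδ => ?_⟩
    calc sSup (f xs '' {y' ∈ Y | ‖y' - ys‖ ≤ r}) ≤ f xs ys := by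
          refine csSup_le ⟨f xs ys, ys, ⟨hys, by simpa using hr.1.le⟩, rfl⟩ ?_
          rintro _ ⟨y, ⟨hy, hyr⟩, rfl⟩
          exact hmax y hy (hyr.trans hr.2)
      _ ≤ _ := (H δ hδ x hx ys hys hxδ (by simpa using hδ.1.le)).2
      _ ≤ _ := sSup_image_ball_mono (henv x hx) hys (hτ δ hδ.1).le hτδ.le
  · rintro ⟨hmax, d, hd, hmin⟩
    obtain ⟨r, hr, hmax⟩ := eventually_nhdsWithin_iff_norm.1 hmax
    obtain ⟨δ₀, hδ₀, τ, hτ, hlim, H⟩ := exists_modulus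
      (P := fun δ ε => ∀ x ∈ X, ‖x - xs‖ ≤ δ →
        f xs ys ≤ sSup (f x '' {y' ∈ Y | ‖y' - ys‖ ≤ ε})) hd
      (fun hle h x hx hxδ => h x hx (hxδ.trans hle))
      (fun hε hle h x hx hxδ =>
        (h x hx hxδ).trans (sSup_image_ball_mono (henv x hx) hys hε.le hle))
      (fun ε hε => by
        obtain ⟨η, hη, h⟩ := eventually_nhdsWithin_iff_norm.1 (hmin ε hε)
        exact ⟨η, hη, fun x hx hxη =>
          (le_sSup_image_ball (henv xs hxs) hys hε.1.le).trans (h x hx hxη)⟩)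
    refine ⟨hxs, hys, min r δ₀, lt_min hr hδ₀, τ, hτ, hlim, fun δ hδ x hx y hy hxδ hyδ => ?_⟩
    exact ⟨hmax y hy (hyδ.trans (hδ.2.trans (min_le_left _ _))),
      H δ ⟨hδ.1, hδ.2.trans (min_le_right _ _)⟩ x hx hxδ⟩

/-- characterization of local minimax points. -/
theorem stmt_1 (n m : ℕ)
    (X : Set (EuclideanSpace ℝ (Fin n))) (Y : Set (EuclideanSpace ℝ (Fin m)))
    (f : EuclideanSpace ℝ (Fin n) → EuclideanSpace ℝ (Fin m) → ℝ)
    (hXne : X.Nonempty) (hXcl : IsClosed X) (hXcv : Convex ℝ X)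
    (hYne : Y.Nonempty) (hYcl : IsClosed Y) (hYcv : Convex ℝ Y)
    (hlip : LocallyLipschitz fun p : EuclideanSpace ℝ (Fin n) × EuclideanSpace ℝ (Fin m) =>
      f p.1 p.2)
    (henv : ∀ x ∈ X, BddAbove (f x '' Y))
    (xs : EuclideanSpace ℝ (Fin n)) (ys : EuclideanSpace ℝ (Fin m))
    (hxs : xs ∈ X) (hys : ys ∈ Y) :
    IsLocalMinimax X Y f xs ys ↔
      (IsLocalMaxOn (f xs) Y ys ∧
        ∃ δ₀ > (0:ℝ), ∀ δ ∈ Ioc (0:ℝ) δ₀,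
          IsLocalMinOn (fun x => sSup (f x '' {y' ∈ Y | ‖y' - ys‖ ≤ δ})) X xs) := by
  exact isLocalMinimax_iff henv hxs hys
end
end

section
/- Let 𝒳 ⊆ ℝⁿ be a closed convex set, let g : ℝⁿ → ℝ be twice semidifferentiable at x̄ ∈ 𝒳, and let x̄ be a local minimizer of g over 𝒳. Then d²g(x̄)(v) ≥ 0 for every v ∈ T°_𝒳(x̄) with dg(x̄)(v) = 0. -/
open Filter Topology Set Metric Bornology RealInnerProductSpace Pointwise

noncomputable section

variable {E : Type*} [NormedAddCommGroup E] [NormedSpace ℝ E]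
variable {F : Type*} [NormedAddCommGroup F] [NormedSpace ℝ F]

/-- second-order necessary condition for a local minimizer over a closed convex set. -/
theorem stmt_4 (n : ℕ) (𝒳 : Set (EuclideanSpace ℝ (Fin n)))
    (g : EuclideanSpace ℝ (Fin n) → ℝ) (xb : EuclideanSpace ℝ (Fin n))
    (hcl : IsClosed 𝒳) (hcv : Convex ℝ 𝒳) (hxb : xb ∈ 𝒳)
    (hsd : TwiceSemidiffAt g xb) (hmin : IsLocalMinOn g 𝒳 xb) :
    ∀ v ∈ feasCone 𝒳 xb, dsub g xb v = 0 → 0 ≤ dsub2 g xb v := by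
  rintro v ⟨l, hl, hlv⟩ hv
  obtain ⟨L, hL⟩ := hsd.2 v
  have hdsub : dsub2 g xb v = L := hL.liminf_eq
  have hslice : Tendsto (fun t : ℝ => (v, t)) (𝓝[>] (0:ℝ)) ((𝓝 v) ×ˢ (𝓝[>] (0:ℝ))) :=
    tendsto_const_nhds.prodMk tendsto_id
  rw [hdsub]
  refine ge_of_tendsto (hL.comp hslice) ?_
  have hfeas : ∀ᶠ t : ℝ in 𝓝[>] 0, xb + t • v ∈ 𝒳 := by
    filter_upwards [Ioc_mem_nhdsGT hl] with t ht
    have h := hcv.add_smul_mem hxb hlv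
      (t := t / l) ⟨div_nonneg ht.1.le hl.le, (div_le_one hl).2 ht.2⟩
    rwa [smul_smul, div_mul_cancel₀ _ hl.ne'] at h
  have hline : Tendsto (fun t : ℝ => xb + t • v) (𝓝[>] 0) (𝓝[𝒳] xb) := by
    refine tendsto_nhdsWithin_iff.2 ⟨?_, hfeas⟩
    have hcont : Continuous fun t : ℝ => xb + t • v := by fun_prop
    exact (by simpa using hcont.tendsto 0 : Tendsto _ (𝓝 (0:ℝ)) (𝓝 xb)).mono_left
      nhdsWithin_le_nhds
  filter_upwards [hline.eventually hmin] with t ht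
  simp only [Function.comp_apply, quot2, hv, mul_zero, sub_zero]
  exact mul_nonneg (EReal.coe_nonneg.2 (by positivity)) (EReal.coe_nonneg.2 (sub_nonneg.2 ht))
end
end

section
/- Let f : ℝⁿ×ℝᵐ → ℝ be continuously differentiable and let (x̂,ŷ) ∈ X×Y be a local minimax point. Then 0 ∈ ∇_x f(x̂,ŷ) + N_X(x̂) and 0 ∈ −∇_y f(x̂,ŷ) + N_Y(ŷ). -/
open Filter Topology Set Metric Bornology RealInnerProductSpace Pointwise

noncomputable section

variable {E : Type*} [NormedAddCommGroup E] [NormedSpace ℝ E]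
variable {F : Type*} [NormedAddCommGroup F] [NormedSpace ℝ F]

theorem mem_singleton_add_normalCone {H : Type*} [NormedAddCommGroup H] [InnerProductSpace ℝ H]
    {Ω : Set H} {x g : H} (h : ∀ ω ∈ Ω, 0 ≤ ⟪g, ω - x⟫) :
    0 ∈ ({g} : Set H) + normalCone Ω x := by
  refine Set.mem_add.2 ⟨g, rfl, -g, fun ω hω => ?_, add_neg_cancel g⟩
  rw [inner_neg_left]
  exact neg_nonpos.2 (h ω hω)

/-- At a local minimax point, the partial derivative of `f` in the minimization variable is
nonnegative in every direction pointing into the convex set `X`. -/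
theorem IsLocalMinimax.fderiv_nonneg {X : Set E} {Y : Set F} {f : E → F → ℝ} {xh : E} {yh : F}
    {f' : E × F →L[ℝ] ℝ} (hmm : IsLocalMinimax X Y f xh yh) (hX : Convex ℝ X)
    (hf : HasStrictFDerivAt (fun p : E × F => f p.1 p.2) f' (xh, yh)) {x : E} (hx : x ∈ X) :
    0 ≤ f' (x - xh, 0) := by
  obtain ⟨hxh, hyh, δ₀, hδ₀, τ, hτ, hτ0, h⟩ := hmm
  by_contra! hneg
  set w := x - xh
  set N := ‖w‖ + 1 with hN
  have hNpos : 0 < N := by positivity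
  set c := -f' (w, 0) / (2 * N) with hc
  have hcpos : 0 < c := div_pos (neg_pos.2 hneg) (by positivity)
  have hev := hf.isLittleO.def hcpos
  obtain ⟨ρ, hρ, hball⟩ := Metric.eventually_nhds_iff.1 hev
  have hτev : ∀ᶠ δ in 𝓝[>] (0 : ℝ), τ δ < min ρ δ₀ :=
    hτ0.eventually (gt_mem_nhds (lt_min hρ hδ₀))
  have hδev : ∀ᶠ δ in 𝓝[>] (0 : ℝ), δ ∈ Ioo 0 (min (min ρ δ₀) N) :=
    Ioo_mem_nhdsGT (lt_min (lt_min hρ hδ₀) hNpos)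
  obtain ⟨δ, hτδ, hδpos, hδlt⟩ := (hτev.and hδev).exists
  simp only [lt_min_iff] at hτδ hδlt
  set t := δ / N
  have htpos : 0 < t := div_pos hδpos hNpos
  have htX : xh + t • w ∈ X :=
    hX.add_smul_sub_mem hxh hx ⟨htpos.le, (div_le_one hNpos).2 hδlt.2.le⟩
  have htN : t * N = δ := div_mul_cancel₀ _ hNpos.ne'
  have hnorm : ‖t • w‖ ≤ δ := by
    rw [norm_smul, Real.norm_of_nonneg htpos.le, ← htN]
    gcongr
    linarith
  have hsup := (h δ ⟨hδpos, hδlt.1.2.le⟩ (xh + t • w) htX yh hyh (by simpa using hnorm)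
    (by simpa using hδpos.le)).2
  have hle : sSup (f (xh + t • w) '' {y' ∈ Y | ‖y' - yh‖ ≤ τ δ}) ≤
      f xh yh + t * (f' (w, 0) / 2) := by
    refine csSup_le ⟨_, yh, ⟨hyh, by simpa using (hτ δ hδpos).le⟩, rfl⟩ ?_
    rintro _ ⟨y, ⟨hyY, hy⟩, rfl⟩
    have hymax := (h δ₀ ⟨hδ₀, le_rfl⟩ xh hxh y hyY (by simpa using hδ₀.le)
      (hy.trans hτδ.2.le)).1
    have hyρ : dist y yh < ρ := by
      rw [dist_eq_norm]
      exact hy.trans_lt hτδ.1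
    have hxρ : ‖t • w‖ < ρ := hnorm.trans_lt hδlt.1.1
    have hest := @hball ((xh + t • w, y), (xh, y)) (by simp [Prod.dist_eq, hyρ, hxρ])
    have hdiff : ((xh + t • w, y) : E × F) - (xh, y) = t • (w, 0) := by ext <;> simp
    have hwnorm : ‖((w, 0) : E × F)‖ ≤ N := by simp [Prod.norm_def, hN]
    have hcN : c * N = -f' (w, 0) / 2 := by
      rw [hc]
      field_simp
    rw [hdiff, map_smul, smul_eq_mul, norm_smul, Real.norm_of_nonneg htpos.le] at hest
    have hbound : c * (t * ‖((w, 0) : E × F)‖) ≤ t * (-f' (w, 0) / 2) := by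
      rw [← hcN, mul_left_comm]
      gcongr
    have habs := (le_abs_self _).trans (hest.trans hbound)
    dsimp only at habs
    linarith
  have : t * (f' (w, 0) / 2) < 0 := mul_neg_of_pos_of_neg htpos (by linarith)
  linarith

theorem IsLocalMinimax.isLocalMaxOn {X : Set E} {Y : Set F} {f : E → F → ℝ} {xh : E} {yh : F}
    (hmm : IsLocalMinimax X Y f xh yh) : IsLocalMaxOn (f xh) Y yh := by
  obtain ⟨hxh, -, δ₀, hδ₀, _, -, -, h⟩ := hmm
  filter_upwards [self_mem_nhdsWithin, mem_nhdsWithin_of_mem_nhds (closedBall_mem_nhds yh hδ₀)]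
    with y hyY hy
  exact (h δ₀ ⟨hδ₀, le_rfl⟩ xh hxh y hyY (by simpa using hδ₀.le) (mem_closedBall_iff_norm.1 hy)).1

/-- first-order necessary optimality conditions at a local minimax point
(smooth case). -/
theorem stmt_8 (n m : ℕ)
    (X : Set (EuclideanSpace ℝ (Fin n))) (Y : Set (EuclideanSpace ℝ (Fin m)))
    (f : EuclideanSpace ℝ (Fin n) → EuclideanSpace ℝ (Fin m) → ℝ)
    (hXne : X.Nonempty) (hXcl : IsClosed X) (hXcv : Convex ℝ X)
    (hYne : Y.Nonempty) (hYcl : IsClosed Y) (hYcv : Convex ℝ Y)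
    (henv : ∀ x ∈ X, BddAbove (f x '' Y))
    (hf : ContDiff ℝ 1
      (fun p : EuclideanSpace ℝ (Fin n) × EuclideanSpace ℝ (Fin m) => f p.1 p.2))
    (xh : EuclideanSpace ℝ (Fin n)) (yh : EuclideanSpace ℝ (Fin m))
    (hmm : IsLocalMinimax X Y f xh yh) :
    (0 ∈ ({gradient (fun x => f x yh) xh} : Set (EuclideanSpace ℝ (Fin n))) +
        normalCone X xh) ∧
    (0 ∈ ({-gradient (fun y => f xh y) yh} : Set (EuclideanSpace ℝ (Fin m))) +
        normalCone Y yh) := by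
  have hs := (hf.hasStrictFDerivAt one_ne_zero : HasStrictFDerivAt _ _ (xh, yh))
  have hd := hs.hasFDerivAt
  have hx : HasFDerivAt (fun x => f x yh) _ xh :=
    hd.comp (f := fun x => (x, yh)) xh (hasFDerivAt_prodMk_left xh yh)
  have hy : HasFDerivAt (fun y => f xh y) _ yh :=
    hd.comp (f := fun y => (xh, y)) yh (hasFDerivAt_prodMk_right xh yh)
  constructor
  · refine mem_singleton_add_normalCone fun x hxX => ?_
    rw [gradient, InnerProductSpace.toDual_symm_apply, hx.fderiv]
    simpa using hmm.fderiv_nonneg hXcv hs hxX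
  · refine mem_singleton_add_normalCone fun y hyY => ?_
    rw [inner_neg_left, gradient, InnerProductSpace.toDual_symm_apply, hy.fderiv]
    exact neg_nonneg.2 (hmm.isLocalMaxOn.hasFDerivWithinAt_nonpos hy.hasFDerivWithinAt
      (sub_mem_posTangentConeAt_of_segment_subset (hYcv.segment_subset hmm.2.1 hyY)))
end
end

section
/- Let f : ℝⁿ×ℝᵐ → ℝ be twice continuously differentiable and let (x̂,ŷ) ∈ X×Y be a local minimax point. Then ⟨v, ∇²_{xx} f(x̂,ŷ) v⟩ ≥ 0 for every v in the closure of the set {v̄ : ∃ δ > 0 such that v̄ ∈ Γ₁°(x̂,y') for all y' ∈ B(ŷ,δ)}, and ⟨w, ∇²_{yy} f(x̂,ŷ) w⟩ ≤ 0 for every w in the closure of Γ₂°(x̂,ŷ). -/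
open Filter Topology Set Metric Bornology RealInnerProductSpace Pointwise

noncomputable section

variable {E : Type*} [NormedAddCommGroup E] [NormedSpace ℝ E]
variable {F : Type*} [NormedAddCommGroup F] [NormedSpace ℝ F]

/-- Γ₁°(x,y). -/
def Gamma1o {n m : ℕ} (X : Set (EuclideanSpace ℝ (Fin n)))
    (f : EuclideanSpace ℝ (Fin n) → EuclideanSpace ℝ (Fin m) → ℝ)
    (x : EuclideanSpace ℝ (Fin n)) (y : EuclideanSpace ℝ (Fin m)) :
    Set (EuclideanSpace ℝ (Fin n)) :=
  {v ∈ feasCone X x | ⟪v, gradient (fun x' => f x' y) x⟫ = 0}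

/-- Γ₂°(x,y). -/
def Gamma2o {n m : ℕ} (Y : Set (EuclideanSpace ℝ (Fin m)))
    (f : EuclideanSpace ℝ (Fin n) → EuclideanSpace ℝ (Fin m) → ℝ)
    (x : EuclideanSpace ℝ (Fin n)) (y : EuclideanSpace ℝ (Fin m)) :
    Set (EuclideanSpace ℝ (Fin m)) :=
  {w ∈ feasCone Y y | ⟪w, gradient (fun y' => f x y') y⟫ = 0}

section SecondOrder

variable {G H : Type*} [NormedAddCommGroup G] [NormedSpace ℝ G]
  [NormedAddCommGroup H] [NormedSpace ℝ H]

/-- Chain rule for the second derivative under precomposition with an affine map. -/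
theorem fderiv_fderiv_comp_affine {g : H → ℝ} (hg : ContDiff ℝ 2 g) (c : H) (L : G →L[ℝ] H)
    (x v w : G) :
    fderiv ℝ (fderiv ℝ fun x => g (c + L x)) x v w =
      fderiv ℝ (fderiv ℝ g) (c + L x) (L v) (L w) := by
  have hA (x : G) : HasFDerivAt (fun x => c + L x) L x := L.hasFDerivAt.const_add c
  have hg' : Differentiable ℝ (fderiv ℝ g) :=
    (hg.fderiv_right (m := 1) (by norm_num)).differentiable (by norm_num)
  have h1 : (fderiv ℝ fun x => g (c + L x)) = fun x => (fderiv ℝ g (c + L x)).comp L := by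
    funext x
    exact ((hg.differentiable (by norm_num) _).hasFDerivAt.comp x (hA x)).fderiv
  have h2 : HasFDerivAt (fun x => fderiv ℝ g (c + L x))
      ((fderiv ℝ (fderiv ℝ g) (c + L x)).comp L) x :=
    (hg' _).hasFDerivAt.comp x (hA x)
  rw [h1, (h2.clm_comp (hasFDerivAt_const L x)).fderiv]
  simp

/-- If the second derivative of `g` at `z₀` is negative along `u`, then `g` decreases
quadratically along `u`, uniformly from all nearby points that are critical in direction `u`. -/
theorem exists_quadratic_decrease {g : H → ℝ} (hg : ContDiff ℝ 2 g) {z₀ u : H}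
    (hneg : fderiv ℝ (fderiv ℝ g) z₀ u u < 0) :
    ∃ c > 0, ∃ ρ > 0, ∀ z ∈ ball z₀ ρ, fderiv ℝ g z u = 0 → ∀ t ∈ Ico (0 : ℝ) ρ,
      g (z + t • u) ≤ g z - c * t ^ 2 := by
  have hg1 : ContDiff ℝ 1 (fderiv ℝ g) := hg.fderiv_right (by norm_num)
  obtain ⟨c, hc⟩ : ∃ c, c = -(fderiv ℝ (fderiv ℝ g) z₀ u u) / 4 := ⟨_, rfl⟩
  have hcont : Continuous fun z => fderiv ℝ (fderiv ℝ g) z u u :=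
    ((hg1.continuous_fderiv (by norm_num)).clm_apply continuous_const).clm_apply
      continuous_const
  have hev : ∀ᶠ z in 𝓝 z₀, fderiv ℝ (fderiv ℝ g) z u u < -2 * c :=
    hcont.continuousAt.eventually_lt continuousAt_const (by linarith)
  obtain ⟨r, hr, hball⟩ := Metric.eventually_nhds_iff.1 hev
  have hu : 0 < 1 + ‖u‖ := by positivity
  refine ⟨c, by linarith, r / (1 + ‖u‖), by positivity, fun z hz hcrit t ht => ?_⟩
  have hline (s : ℝ) : HasDerivAt (fun s : ℝ => z + s • u) u s := by
    simpa using ((hasDerivAt_id s).smul_const u).const_add z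
  have hφ (s : ℝ) : HasDerivAt (fun s => g (z + s • u) + c * s ^ 2)
      (fderiv ℝ g (z + s • u) u + 2 * c * s) s := by
    have := ((hg.differentiable (by norm_num) _).hasFDerivAt.comp_hasDerivAt s (hline s)).add
      ((hasDerivAt_pow 2 s).const_mul c)
    refine this.congr_deriv ?_
    push_cast
    ring
  have hψ (s : ℝ) : HasDerivAt (fun s => fderiv ℝ g (z + s • u) u + 2 * c * s)
      (fderiv ℝ (fderiv ℝ g) (z + s • u) u u + 2 * c) s := by
    have := (((hg1.differentiable (by norm_num) _).hasFDerivAt.comp_hasDerivAt s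
      (hline s)).clm_apply (hasDerivAt_const s u)).add ((hasDerivAt_id s).const_mul (2 * c))
    exact this.congr_deriv (by simp)
  have hψ_anti : AntitoneOn (fun s => fderiv ℝ g (z + s • u) u + 2 * c * s) (Icc 0 t) := by
    refine antitoneOn_of_deriv_nonpos (convex_Icc 0 t)
      (fun s _ => (hψ s).continuousAt.continuousWithinAt)
      (fun s _ => (hψ s).differentiableAt.differentiableWithinAt) fun s hs => ?_
    rw [interior_Icc] at hs
    rw [(hψ s).deriv]
    have hdist : dist (z + s • u) z₀ < r := by
      calc dist (z + s • u) z₀ ≤ dist (z + s • u) z + dist z z₀ := dist_triangle _ _ _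
        _ = s * ‖u‖ + dist z z₀ := by
          rw [dist_self_add_left, norm_smul, Real.norm_of_nonneg hs.1.le]
        _ < r / (1 + ‖u‖) * ‖u‖ + r / (1 + ‖u‖) :=
          add_lt_add_of_le_of_lt
            (mul_le_mul_of_nonneg_right (hs.2.trans ht.2).le (norm_nonneg u)) hz
        _ = r := by field_simp; ring
    linarith [hball hdist]
  have hφ_anti : AntitoneOn (fun s => g (z + s • u) + c * s ^ 2) (Icc 0 t) := by
    refine antitoneOn_of_deriv_nonpos (convex_Icc 0 t)
      (fun s _ => (hφ s).continuousAt.continuousWithinAt)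
      (fun s _ => (hφ s).differentiableAt.differentiableWithinAt) fun s hs => ?_
    rw [interior_Icc] at hs
    rw [(hφ s).deriv]
    have := hψ_anti (left_mem_Icc.2 ht.1) (Ioo_subset_Icc_self hs) hs.1.le
    simpa [hcrit] using this
  have := hφ_anti (left_mem_Icc.2 ht.1) (right_mem_Icc.2 ht.1) ht.1
  simp only [zero_smul, add_zero] at this
  linarith

theorem isClosed_setOf_iteratedFDeriv_two_nonneg (g : G → ℝ) (x : G) :
    IsClosed {v | 0 ≤ iteratedFDeriv ℝ 2 g x ![v, v]} := by
  simp only [iteratedFDeriv_two_apply, Matrix.cons_val_zero, Matrix.cons_val_one]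
  exact isClosed_le continuous_const
    (((fderiv ℝ (fderiv ℝ g) x).continuous).clm_apply continuous_id)

/-- A feasible direction of a convex set stays feasible for all small step lengths. -/
theorem eventually_mem_of_mem_feasCone {Ω : Set G} (hΩ : Convex ℝ Ω) {x w : G} (hx : x ∈ Ω)
    (hw : w ∈ feasCone Ω x) : ∀ᶠ t in 𝓝[>] (0 : ℝ), x + t • w ∈ Ω := by
  obtain ⟨l, hl, hmem⟩ := hw
  filter_upwards [Ioc_mem_nhdsGT hl] with t ht
  have := hΩ.add_smul_mem hx hmem (t := t / l) ⟨by have := ht.1; positivity,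
    (div_le_one hl).2 ht.2⟩
  rwa [smul_smul, div_mul_cancel₀ _ hl.ne'] at this

end SecondOrder

/-- second-order necessary optimality conditions at a local minimax point
(smooth case). -/
theorem stmt_9 (n m : ℕ)
    (X : Set (EuclideanSpace ℝ (Fin n))) (Y : Set (EuclideanSpace ℝ (Fin m)))
    (f : EuclideanSpace ℝ (Fin n) → EuclideanSpace ℝ (Fin m) → ℝ)
    (hXne : X.Nonempty) (hXcl : IsClosed X) (hXcv : Convex ℝ X)
    (hYne : Y.Nonempty) (hYcl : IsClosed Y) (hYcv : Convex ℝ Y)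
    (henv : ∀ x ∈ X, BddAbove (f x '' Y))
    (hf : ContDiff ℝ 2
      (fun p : EuclideanSpace ℝ (Fin n) × EuclideanSpace ℝ (Fin m) => f p.1 p.2))
    (xh : EuclideanSpace ℝ (Fin n)) (yh : EuclideanSpace ℝ (Fin m))
    (hmm : IsLocalMinimax X Y f xh yh) :
    (∀ v ∈ closure {vb : EuclideanSpace ℝ (Fin n) |
        ∃ δ > (0:ℝ), ∀ y' ∈ Metric.closedBall yh δ, vb ∈ Gamma1o X f xh y'},
      0 ≤ iteratedFDeriv ℝ 2 (fun x => f x yh) xh ![v, v]) ∧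
    (∀ w ∈ closure (Gamma2o Y f xh yh),
      iteratedFDeriv ℝ 2 (fun y => f xh y) yh ![w, w] ≤ 0) := by
  set F : EuclideanSpace ℝ (Fin n) × EuclideanSpace ℝ (Fin m) → ℝ := fun p => f p.1 p.2 with hF
  obtain ⟨hxX, hyY, δ₀, hδ₀, τ, hτpos, hτ, hloc⟩ := hmm
  have hloc_y : ∀ y ∈ Y, ‖y - yh‖ ≤ δ₀ → f xh y ≤ f xh yh := fun y hy hyδ =>
    (hloc δ₀ ⟨hδ₀, le_rfl⟩ xh hxX y hy (by simpa using hδ₀.le) hyδ).1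
  constructor
  · refine fun v hv => closure_minimal ?_
      (isClosed_setOf_iteratedFDeriv_two_nonneg (fun x => f x yh) xh) hv
    rintro v ⟨δ, hδ, hvδ⟩
    by_contra! hneg
    have hD2 : fderiv ℝ (fderiv ℝ F) (xh, yh) (v, 0) (v, 0) < 0 := by
      have := fderiv_fderiv_comp_affine hf (0, yh)
        (ContinuousLinearMap.inl ℝ (EuclideanSpace ℝ (Fin n)) (EuclideanSpace ℝ (Fin m))) xh v v
      simp only [ContinuousLinearMap.inl_apply, Prod.mk_add_mk, zero_add, add_zero] at this
      rw [← this]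
      simpa [iteratedFDeriv_two_apply] using hneg
    obtain ⟨c, hc, ρ, hρ, hdec⟩ := exists_quadratic_decrease hf hD2
    have hcrit : ∀ y ∈ closedBall yh δ, fderiv ℝ F (xh, y) (v, 0) = 0 := by
      intro y hy
      have h0 := (hvδ y hy).2
      have hx : HasFDerivAt (fun x => f x y) ((fderiv ℝ F (xh, y)).comp
          (ContinuousLinearMap.inl ℝ _ _)) xh :=
        ((hf.differentiable (by norm_num) _).hasFDerivAt.comp xh (hasFDerivAt_prodMk_left xh y))
      rwa [inner_gradient_right, hx.fderiv] at h0
    have hstep : Tendsto (fun t : ℝ => t * (‖v‖ + 1)) (𝓝[>] 0) (𝓝[>] 0) := by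
      refine tendsto_nhdsWithin_iff.2 ⟨?_, ?_⟩
      · have : Continuous fun t : ℝ => t * (‖v‖ + 1) := by fun_prop
        simpa using (this.tendsto 0).mono_left nhdsWithin_le_nhds
      · filter_upwards [self_mem_nhdsWithin] with t ht
        have : 0 < t := ht
        exact mem_Ioi.2 (by positivity)
    have hτ_small : ∀ᶠ d in 𝓝[>] (0 : ℝ), τ d < min δ (min δ₀ ρ) :=
      hτ.eventually_lt_const (by positivity)
    have hfeas := eventually_mem_of_mem_feasCone hXcv hxX
      (hvδ yh (mem_closedBall_self hδ.le)).1
    obtain ⟨t, htX, htρ, htτ, htδ⟩ := (hfeas.and (Eventually.and (Ioo_mem_nhdsGT hρ)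
      ((hstep.eventually hτ_small).and (hstep.eventually (Ioc_mem_nhdsGT hδ₀))))).exists
    have ht0 : 0 < t := htρ.1
    have hle := (hloc _ htδ _ htX yh hyY (by
      rw [add_sub_cancel_left, norm_smul, Real.norm_of_nonneg ht0.le]
      nlinarith) (by simpa using htδ.1.le)).2
    have hsup : sSup (f (xh + t • v) '' {y' ∈ Y | ‖y' - yh‖ ≤ τ (t * (‖v‖ + 1))}) ≤
        f xh yh - c * t ^ 2 := by
      refine csSup_le ⟨_, yh, ⟨hyY, by simpa using (hτpos _ htδ.1).le⟩, rfl⟩ ?_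
      rintro _ ⟨y, ⟨hy, hyτ⟩, rfl⟩
      have hyr := hyτ.trans_lt htτ
      simp only [lt_min_iff] at hyr
      have hz : (xh, y) ∈ ball (xh, yh) ρ := by
        simpa [Prod.dist_eq, dist_eq_norm, hρ] using hyr.2.2
      have hyδ : y ∈ closedBall yh δ := by
        simpa [mem_closedBall, dist_eq_norm] using hyr.1.le
      have h1 := hdec _ hz (hcrit y hyδ) t ⟨ht0.le, htρ.2⟩
      simp only [hF, Prod.smul_mk, smul_zero, Prod.mk_add_mk, add_zero] at h1
      linarith [hloc_y y hy hyr.2.1.le]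
    have : 0 < c * t ^ 2 := by positivity
    linarith
  · have hG : ContDiff ℝ 2 (-fun y => f xh y) := (hf.comp (contDiff_prodMk_right xh)).neg
    refine fun w hw => neg_nonneg.1 ?_
    have hneg_iter (w : EuclideanSpace ℝ (Fin m)) :
        iteratedFDeriv ℝ 2 (-fun y => f xh y) yh ![w, w] =
          -iteratedFDeriv ℝ 2 (fun y => f xh y) yh ![w, w] := by
      rw [iteratedFDeriv_neg]
      rfl
    rw [← hneg_iter]
    refine closure_minimal ?_ (isClosed_setOf_iteratedFDeriv_two_nonneg _ yh) hw
    rintro w ⟨hwfeas, hw0⟩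
    by_contra! hneg
    obtain ⟨c, hc, ρ, hρ, hdec⟩ := exists_quadratic_decrease hG
      (z₀ := yh) (u := w) (by simpa [iteratedFDeriv_two_apply] using hneg)
    have hcrit : fderiv ℝ (-fun y => f xh y) yh w = 0 := by
      rw [inner_gradient_right] at hw0
      rw [fderiv_neg]
      simpa using hw0
    have hsmall : ∀ᶠ t in 𝓝[>] (0 : ℝ), ‖t • w‖ < δ₀ := by
      have : Continuous fun t : ℝ => ‖t • w‖ := by fun_prop
      exact ((this.tendsto 0).mono_left nhdsWithin_le_nhds).eventually_lt_const (by simpa)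
    obtain ⟨t, htY, htρ, htδ⟩ := ((eventually_mem_of_mem_feasCone hYcv hyY hwfeas).and
      (Eventually.and (Ioo_mem_nhdsGT hρ) hsmall)).exists
    have h1 := hdec yh (mem_ball_self hρ) hcrit t ⟨htρ.1.le, htρ.2⟩
    have h2 := hloc_y _ htY (by simpa using htδ.le)
    have ht0 : 0 < t := htρ.1
    have : 0 < c * t ^ 2 := by positivity
    simp only [Pi.neg_apply] at h1
    linarith
end
end

section
/- Let X = {x ∈ ℝⁿ : Ax ≤ b} and Y = {y ∈ ℝᵐ : Cy ≤ d} be nonempty, with A ∈ ℝ^{p×n}, b ∈ ℝ^p, C ∈ ℝ^{q×m}, d ∈ ℝ^q, let f : ℝⁿ×ℝᵐ → ℝ be continuously differentiable, and let (x̂,ŷ) ∈ X×Y be a local minimax point. Then there exist multipliers α ∈ ℝ^p and β ∈ ℝ^q such that ∇_x f(x̂,ŷ) − Σ_{i=1}^p α_i A_i = 0, −∇_y f(x̂,ŷ) − Σ_{j=1}^q β_j C_j = 0, α ∈ N_{ℝ₊^p}(b − Ax̂) and β ∈ N_{ℝ₊^q}(d − Cŷ) (equivalently, α ≤ 0 componentwise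 with α_i (b − Ax̂)_i = 0 for all i, and β ≤ 0 componentwise with β_j (d − Cŷ)_j = 0 for all j), where A_i and C_j denote the i-th row of A and the j-th row of C. -/
open Filter Topology Set Metric Bornology RealInnerProductSpace Pointwise

noncomputable section

variable {E : Type*} [NormedAddCommGroup E] [NormedSpace ℝ E]
variable {F : Type*} [NormedAddCommGroup F] [NormedSpace ℝ F]

/-- **Farkas lemma**: a vector whose inner product is nonpositive on the polar of a finite family
is a nonnegative combination of that family. -/
theorem exists_nonneg_combination_of_forall_inner_nonpos {H ι : Type*} [NormedAddCommGroup H]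
    [InnerProductSpace ℝ H] (s : Finset ι) (a : ι → H) (c : H)
    (h : ∀ v, (∀ i ∈ s, ⟪a i, v⟫ ≤ 0) → ⟪c, v⟫ ≤ 0) :
    ∃ l : ι → ℝ, (∀ i, 0 ≤ l i) ∧ (∀ i ∉ s, l i = 0) ∧ c = ∑ i ∈ s, l i • a i := by
  classical
  induction s using Finset.induction_on generalizing a c with
  | empty =>
    refine ⟨0, fun _ => le_rfl, fun _ _ => rfl, ?_⟩
    have hc : ⟪c, c⟫ ≤ 0 := h c (by simp)
    simpa using hc
  | insert k s hk ih =>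
    by_cases hs : ∀ v, (∀ i ∈ s, ⟪a i, v⟫ ≤ 0) → ⟪c, v⟫ ≤ 0
    · obtain ⟨l, hl, hl0, rfl⟩ := ih a c hs
      refine ⟨l, hl, fun i hi => hl0 i fun his => hi (Finset.mem_insert_of_mem his), ?_⟩
      rw [Finset.sum_insert hk, hl0 k hk, zero_smul, zero_add]
    · push Not at hs
      obtain ⟨u, hu, hcu⟩ := hs
      have hku : 0 < ⟪a k, u⟫ := by
        by_contra! hle
        exact hcu.not_ge (h u fun i hi => (Finset.mem_insert.1 hi).elim (fun e => e ▸ hle) (hu i))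
      obtain ⟨l, hl, hl0, hc⟩ := ih (fun i => a i - (⟪a i, u⟫ / ⟪a k, u⟫) • a k)
        (c - (⟪c, u⟫ / ⟪a k, u⟫) • a k) (by
          intro v hv
          have key : ∀ w : H, ⟪w - (⟪w, u⟫ / ⟪a k, u⟫) • a k, v⟫
              = ⟪w, v - (⟪a k, v⟫ / ⟪a k, u⟫) • u⟫ := by
            intro w
            rw [inner_sub_left, inner_sub_right, real_inner_smul_left, real_inner_smul_right]
            ring
          rw [key]
          refine h _ fun i hi => ?_
          rcases Finset.mem_insert.1 hi with rfl | hi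
          · rw [inner_sub_right, real_inner_smul_right, div_mul_cancel₀ _ hku.ne', sub_self]
          · rw [← key]
            exact hv i hi)
      set r : ℝ := ⟪c, u⟫ / ⟪a k, u⟫ - ∑ i ∈ s, l i * (⟪a i, u⟫ / ⟪a k, u⟫) with hr
      have hr0 : 0 ≤ r := by
        have h1 : 0 ≤ ⟪c, u⟫ / ⟪a k, u⟫ := by positivity
        have h2 : ∑ i ∈ s, l i * (⟪a i, u⟫ / ⟪a k, u⟫) ≤ 0 := Finset.sum_nonpos fun i hi =>
          mul_nonpos_of_nonneg_of_nonpos (hl i) (div_nonpos_of_nonpos_of_nonneg (hu i hi) hku.le)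
        linarith
      refine ⟨Function.update l k r, fun i => ?_, fun i hi => ?_, ?_⟩
      · by_cases hik : i = k
        · simpa [hik] using hr0
        · simpa [hik] using hl i
      · rw [Finset.mem_insert, not_or] at hi
        simpa [hi.1] using hl0 i hi.2
      · have hsum : ∑ i ∈ s, Function.update l k r i • a i = ∑ i ∈ s, l i • a i :=
          Finset.sum_congr rfl fun i hi => by
            rw [Function.update_of_ne (ne_of_mem_of_not_mem hi hk)]
        rw [Finset.sum_insert hk, hsum, Function.update_self, hr, sub_smul, Finset.sum_smul]
        rw [sub_eq_iff_eq_add] at hc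
        simp only [smul_sub, Finset.sum_sub_distrib, smul_smul] at hc
        exact hc.trans (by abel)

/-- Multipliers for a vector which is nonnegative on the feasible directions of a polyhedron. -/
theorem exists_multipliers_of_forall_feasible {H ι : Type*} [NormedAddCommGroup H]
    [InnerProductSpace ℝ H] [Fintype ι] (a : ι → H) (b : ι → ℝ) (x g : H)
    (hx : ∀ i, ⟪a i, x⟫ ≤ b i)
    (h : ∀ v, (∀ᶠ t : ℝ in 𝓝[>] 0, ∀ i, ⟪a i, x + t • v⟫ ≤ b i) → 0 ≤ ⟪g, v⟫) :
    ∃ l : ι → ℝ, g = ∑ i, l i • a i ∧ (∀ i, l i ≤ 0) ∧ ∀ i, l i * (b i - ⟪a i, x⟫) = 0 := by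
  classical
  obtain ⟨l, hl, hl0, hg⟩ := exists_nonneg_combination_of_forall_inner_nonpos
    (Finset.univ.filter fun i => ⟪a i, x⟫ = b i) a (-g) (by
      intro v hv
      rw [inner_neg_left, neg_nonpos]
      refine h v (eventually_all.2 fun i => ?_)
      rcases (hx i).eq_or_lt with hi | hi
      · filter_upwards [self_mem_nhdsWithin] with t ht
        have hiv := hv i (by simpa using hi)
        rw [inner_add_right, real_inner_smul_right, hi]
        linarith [mul_nonpos_of_nonneg_of_nonpos (le_of_lt ht) hiv]
      · have hcont : Continuous fun t : ℝ => ⟪a i, x + t • v⟫ := by fun_prop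
        have hlim := hcont.tendsto 0
        simp only [zero_smul, add_zero] at hlim
        exact ((hlim.eventually_lt_const hi).filter_mono nhdsWithin_le_nhds).mono
          fun t ht => ht.le)
  refine ⟨fun i => -l i, ?_, fun i => neg_nonpos.2 (hl i), fun i => ?_⟩
  · rw [← neg_neg g, hg]
    simp only [neg_smul, Finset.sum_neg_distrib]
    rw [Finset.sum_subset (Finset.subset_univ _) fun i _ hi => by rw [hl0 i hi, zero_smul]]
  · by_cases hi : ⟪a i, x⟫ = b i
    · simp [hi]
    · simp [hl0 i (by simpa using hi)]

/-- At a local minimax point, the partial derivative in `x` is nonnegative along the directions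
that are feasible for `X`. -/
theorem IsLocalMinimax.fderiv_left_nonneg {E F : Type*} [NormedAddCommGroup E] [NormedSpace ℝ E]
    [NormedAddCommGroup F] [NormedSpace ℝ F] [ProperSpace F] {X : Set E} {Y : Set F}
    {f : E → F → ℝ} {x : E} {y : F} (h : IsLocalMinimax X Y f x y) (hY : IsClosed Y)
    (hf : ContDiff ℝ 1 fun z : E × F => f z.1 z.2) {v : E}
    (hv : ∀ᶠ t : ℝ in 𝓝[>] 0, x + t • v ∈ X) :
    0 ≤ fderiv ℝ (fun z : E × F => f z.1 z.2) (x, y) (v, 0) := by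
  obtain ⟨hx, hy, δ₀, hδ₀, τ, hτpos, hτ, hmm⟩ := h
  set G : E × F → ℝ := fun z => f z.1 z.2 with hG
  by_contra! hneg
  have hcont : Continuous fun z => fderiv ℝ G z (v, 0) :=
    (hf.continuous_fderiv one_ne_zero).clm_apply continuous_const
  obtain ⟨r, hr, hball⟩ := Metric.eventually_nhds_iff.1
    (hcont.continuousAt.eventually_lt_const hneg)
  have hlin : Tendsto (fun t : ℝ => t * (‖v‖ + 1)) (𝓝[>] 0) (𝓝[>] 0) := by
    refine tendsto_nhdsWithin_iff.2 ⟨?_, ?_⟩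
    · have : Continuous fun t : ℝ => t * (‖v‖ + 1) := by fun_prop
      simpa using (this.tendsto 0).mono_left nhdsWithin_le_nhds
    · filter_upwards [self_mem_nhdsWithin] with t ht
      have ht' : 0 < t := ht
      exact mul_pos ht' (by positivity)
  have hlin' := hlin.mono_right nhdsWithin_le_nhds
  have hpos : ∀ᶠ t : ℝ in 𝓝[>] 0, 0 < t := self_mem_nhdsWithin
  obtain ⟨t, htX, ht, htδ, htr, htτ, htτ'⟩ := (hv.and (hpos.and
    ((hlin'.eventually_lt_const hδ₀).and ((hlin'.eventually_lt_const hr).and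
    (((hτ.comp hlin).eventually_lt_const hr).and
      ((hτ.comp hlin).eventually_lt_const hδ₀)))))).exists
  simp only [Function.comp_apply] at htτ htτ'
  set δ := t * (‖v‖ + 1) with hδ
  have hδpos : 0 < δ := by positivity
  have hnorm : ∀ s ∈ Icc (0 : ℝ) t, ‖s • v‖ ≤ δ := by
    intro s hs
    rw [norm_smul, Real.norm_of_nonneg hs.1, hδ]
    nlinarith [norm_nonneg v, hs.1, hs.2]
  have hle := (hmm δ ⟨hδpos, htδ.le⟩ (x + t • v) htX y hy
    (by simpa using hnorm t ⟨ht.le, le_rfl⟩) (by simpa using hδpos.le)).2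
  have hK : IsCompact {y' ∈ Y | ‖y' - y‖ ≤ τ δ} := by
    have : {y' ∈ Y | ‖y' - y‖ ≤ τ δ} = Y ∩ closedBall y (τ δ) := by
      ext; simp [dist_eq_norm]
    rw [this]
    exact (isCompact_closedBall _ _).inter_left hY
  have hfc : Continuous (f (x + t • v)) :=
    hf.continuous.comp (continuous_const.prodMk continuous_id)
  obtain ⟨y', ⟨hy'Y, hy'⟩, hsup⟩ := (hK.image hfc).sSup_mem
    (Set.Nonempty.image _ ⟨y, hy, by simpa using (hτpos δ hδpos).le⟩)
  have hle' := (hmm δ₀ ⟨hδ₀, le_rfl⟩ x hx y' hy'Y (by simpa using hδ₀.le)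
    (hy'.trans htτ'.le)).1
  have hderiv : ∀ s : ℝ, HasDerivAt (fun s : ℝ => G (x + s • v, y'))
      (fderiv ℝ G (x + s • v, y') (v, 0)) s := by
    intro s
    have h1 : HasDerivAt (fun s : ℝ => (x + s • v, y')) (v, (0 : F)) s := by
      have h2 : HasDerivAt (fun s : ℝ => x + s • v) v s := by
        simpa using ((hasDerivAt_id s).smul_const v).const_add x
      exact h2.prodMk (hasDerivAt_const s y')
    exact ((hf.differentiable one_ne_zero _).hasFDerivAt).comp_hasDerivAt s h1
  obtain ⟨s, hs, hslope⟩ := exists_hasDerivAt_eq_slope (fun s : ℝ => G (x + s • v, y')) _ ht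
    (fun s _ => (hderiv s).continuousAt.continuousWithinAt) (fun s _ => hderiv s)
  have hlt : fderiv ℝ G (x + s • v, y') (v, 0) < 0 := by
    apply hball
    rw [Prod.dist_eq, max_lt_iff, dist_eq_norm, dist_eq_norm]
    exact ⟨by simpa using (hnorm s ⟨hs.1.le, hs.2.le⟩).trans_lt htr, hy'.trans_lt htτ⟩
  rw [hslope] at hlt
  refine hlt.not_ge (div_nonneg ?_ (by linarith))
  simp only [hG, zero_smul, add_zero]
  linarith

/-- At a local minimax point, the partial derivative in `y` is nonpositive along the directions
that are feasible for `Y`. -/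
theorem IsLocalMinimax.fderiv_right_nonpos {E F : Type*} [NormedAddCommGroup E] [NormedSpace ℝ E]
    [NormedAddCommGroup F] [NormedSpace ℝ F] {X : Set E} {Y : Set F}
    {f : E → F → ℝ} {x : E} {y : F} (h : IsLocalMinimax X Y f x y)
    (hf : DifferentiableAt ℝ (f x) y) {v : F}
    (hv : ∀ᶠ t : ℝ in 𝓝[>] 0, y + t • v ∈ Y) :
    fderiv ℝ (f x) y v ≤ 0 := by
  obtain ⟨hx, hy, δ₀, hδ₀, τ, -, -, hmm⟩ := h
  have hlim := (hf.hasFDerivAt.hasLineDerivAt v).tendsto_slope_zero_right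
  have hcont : Continuous fun t : ℝ => ‖t • v‖ := by fun_prop
  have hsmall : ∀ᶠ t : ℝ in 𝓝[>] 0, ‖t • v‖ < δ₀ :=
    (hcont.continuousAt.eventually_lt_const (by simpa using hδ₀)).filter_mono nhdsWithin_le_nhds
  refine le_of_tendsto hlim ?_
  filter_upwards [hv, hsmall, self_mem_nhdsWithin] with t ht htδ htpos
  have hle := (hmm δ₀ ⟨hδ₀, le_rfl⟩ x hx _ ht (by simpa using hδ₀.le) (by simpa using htδ.le)).1
  exact mul_nonpos_of_nonneg_of_nonpos (inv_nonneg.2 (le_of_lt htpos)) (sub_nonpos.2 hle)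

/-- first-order KKT conditions at a local minimax point for polyhedral
constraint sets. -/
theorem stmt_11 (n m p q : ℕ)
    (A : Fin p → EuclideanSpace ℝ (Fin n)) (b : Fin p → ℝ)
    (C : Fin q → EuclideanSpace ℝ (Fin m)) (d : Fin q → ℝ)
    (f : EuclideanSpace ℝ (Fin n) → EuclideanSpace ℝ (Fin m) → ℝ)
    (hXne : {x : EuclideanSpace ℝ (Fin n) | ∀ i, ⟪A i, x⟫ ≤ b i}.Nonempty)
    (hYne : {y : EuclideanSpace ℝ (Fin m) | ∀ j, ⟪C j, y⟫ ≤ d j}.Nonempty)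
    (hf : ContDiff ℝ 1
      (fun z : EuclideanSpace ℝ (Fin n) × EuclideanSpace ℝ (Fin m) => f z.1 z.2))
    (xh : EuclideanSpace ℝ (Fin n)) (yh : EuclideanSpace ℝ (Fin m))
    (hmm : IsLocalMinimax {x | ∀ i, ⟪A i, x⟫ ≤ b i} {y | ∀ j, ⟪C j, y⟫ ≤ d j} f xh yh) :
    ∃ (α : Fin p → ℝ) (β : Fin q → ℝ),
      gradient (fun x => f x yh) xh = ∑ i, α i • A i ∧
      -gradient (fun y => f xh y) yh = ∑ j, β j • C j ∧
      (∀ i, α i ≤ 0) ∧ (∀ i, α i * (b i - ⟪A i, xh⟫) = 0) ∧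
      (∀ j, β j ≤ 0) ∧ (∀ j, β j * (d j - ⟪C j, yh⟫) = 0) := by
  have hdiff : Differentiable ℝ
      (fun z : EuclideanSpace ℝ (Fin n) × EuclideanSpace ℝ (Fin m) => f z.1 z.2) :=
    hf.differentiable one_ne_zero
  have hdx : HasFDerivAt (fun x => f x yh)
      ((fderiv ℝ (fun z : EuclideanSpace ℝ (Fin n) × EuclideanSpace ℝ (Fin m) => f z.1 z.2)
        (xh, yh)).comp (ContinuousLinearMap.inl ℝ _ _)) xh :=
    HasFDerivAt.comp (f := fun x => (x, yh)) xh (hdiff (xh, yh)).hasFDerivAt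
      (hasFDerivAt_prodMk_left xh yh)
  have hdy : DifferentiableAt ℝ (f xh) yh :=
    (HasFDerivAt.comp (f := fun y => (xh, y)) yh (hdiff (xh, yh)).hasFDerivAt
      (hasFDerivAt_prodMk_right xh yh)).differentiableAt
  have hYc : IsClosed {y : EuclideanSpace ℝ (Fin m) | ∀ j, ⟪C j, y⟫ ≤ d j} := by
    simp only [ofPred_forall]
    exact isClosed_iInter fun j => isClosed_le (by fun_prop) continuous_const
  obtain ⟨α, hα, hα0, hαc⟩ := exists_multipliers_of_forall_feasible A b xh
    (gradient (fun x => f x yh) xh) hmm.1 fun v hv => by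
      have h := hmm.fderiv_left_nonneg hYc hf hv
      rw [gradient, InnerProductSpace.toDual_symm_apply, hdx.fderiv]
      simpa using h
  obtain ⟨β, hβ, hβ0, hβc⟩ := exists_multipliers_of_forall_feasible C d yh
    (-gradient (fun y => f xh y) yh) hmm.2.1 fun v hv => by
      have h := hmm.fderiv_right_nonpos hdy hv
      rw [inner_neg_left, gradient, InnerProductSpace.toDual_symm_apply]
      exact neg_nonneg.2 h
  exact ⟨α, β, hα, hβ, hα0, hαc, hβ0, hβc⟩
end
end

section
/- Let X = {x ∈ ℝⁿ : Ax ≤ b} and Y = {y ∈ ℝᵐ : Cy ≤ d} be nonempty, let f : ℝⁿ×ℝᵐ → ℝ be twice continuously differentiable, and let (x̂,ŷ) ∈ X×Y be a local minimax point. Then ⟨v, ∇²_{xx} f(x̂,ŷ) v⟩ ≥ 0 for every v ∈ {λ ∈ T_X(x̂) : ∃ δ > 0 such that λᵀ∇_x f(x̂,y') = 0 for all y' ∈ B(ŷ,δ)}, and ⟨w, ∇²_{yy} f(x̂,ŷ) w⟩ ≤ 0 for every w ∈ {μ ∈ T_Y(ŷ) : μᵀ∇_y f(x̂,ŷ) =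 0}. -/
open Filter Topology Set Metric Bornology RealInnerProductSpace Pointwise

noncomputable section

variable {E : Type*} [NormedAddCommGroup E] [NormedSpace ℝ E]
variable {F : Type*} [NormedAddCommGroup F] [NormedSpace ℝ F]

/-- Second-order Taylor upper bound along a segment at a critical point. -/
theorem le_add_sq_of_second_deriv_le {φ φ' φ'' : ℝ → ℝ} {η c : ℝ}
    (h1 : ∀ t, HasDerivAt φ (φ' t) t) (h2 : ∀ t, HasDerivAt φ' (φ'' t) t)
    (h0 : φ' 0 = 0) (hc : ∀ t ∈ Icc 0 η, φ'' t ≤ c) :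
    ∀ t ∈ Icc 0 η, φ t ≤ φ 0 + c / 2 * t ^ 2 := by
  have key : ∀ ψ ψ' : ℝ → ℝ, (∀ t, HasDerivAt ψ (ψ' t) t) → (∀ t ∈ Icc 0 η, ψ' t ≤ 0) →
      ∀ t ∈ Icc 0 η, ψ t ≤ ψ 0 := by
    intro ψ ψ' h h' t ht
    have hanti : AntitoneOn ψ (Icc 0 η) := by
      refine antitoneOn_of_deriv_nonpos (convex_Icc 0 η)
        (fun s _ => (h s).continuousAt.continuousWithinAt)
        (fun s _ => (h s).differentiableAt.differentiableWithinAt) fun s hs => ?_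
      rw [(h s).deriv]
      exact h' s (interior_subset hs)
    exact hanti ⟨le_rfl, ht.1.trans ht.2⟩ ht ht.1
  have hφ' : ∀ t ∈ Icc 0 η, φ' t - c * t ≤ 0 := by
    intro t ht
    have h := key (fun t => φ' t - c * t) (fun t => φ'' t - c)
      (fun s => by
        have h := (h2 s).sub ((hasDerivAt_id' s).const_mul c)
        rw [mul_one] at h
        exact h)
      (fun s hs => sub_nonpos.2 (hc s hs)) t ht
    simpa [h0] using h
  intro t ht
  have h := key (fun t => φ t - c / 2 * t ^ 2) (fun t => φ' t - c * t)
    (fun s => by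
      have h := (h1 s).sub ((hasDerivAt_pow 2 s).const_mul (c / 2))
      rw [show c / 2 * (((2 : ℕ) : ℝ) * s ^ (2 - 1)) = c * s by norm_num; ring] at h
      exact h) hφ' t ht
  simp only [ne_eq, OfNat.ofNat_ne_zero, not_false_eq_true, zero_pow, mul_zero, sub_zero] at h
  linarith

/-- Moving in polyhedral sets along tangent directions stays feasible for small steps. -/
theorem eventually_add_smul_mem_of_mem_tangentConeSeq {H ι : Type*} [NormedAddCommGroup H]
    [InnerProductSpace ℝ H] [Finite ι] {A : ι → H} {b : ι → ℝ} {x v : H}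
    (hx : ∀ i, ⟪A i, x⟫ ≤ b i)
    (hv : v ∈ tangentConeSeq {x : H | ∀ i, ⟪A i, x⟫ ≤ b i} x) :
    ∀ᶠ t in 𝓝[>] (0 : ℝ), x + t • v ∈ {x : H | ∀ i, ⟪A i, x⟫ ≤ b i} := by
  obtain ⟨xk, tk, hmem, -, htpos, -, hlim⟩ := hv
  simp only [mem_ofPred_eq]
  rw [eventually_all]
  intro i
  rcases (hx i).lt_or_eq with hlt | heq
  · have hcont : Continuous fun t : ℝ => ⟪A i, x + t • v⟫ := by fun_prop
    have h0 : ⟪A i, x + (0 : ℝ) • v⟫ < b i := by simpa using hlt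
    exact nhdsWithin_le_nhds
      ((hcont.continuousAt.eventually_lt continuousAt_const h0).mono fun t ht => ht.le)
  · have hAv : ⟪A i, v⟫ ≤ 0 := by
      refine le_of_tendsto' ((tendsto_const_nhds (x := A i)).inner hlim) fun k => ?_
      rw [inner_smul_right, inner_sub_right]
      exact mul_nonpos_of_nonneg_of_nonpos (inv_nonneg.2 (htpos k).le)
        (by linarith [hmem k i])
    filter_upwards [self_mem_nhdsWithin] with t ht
    rw [inner_add_right, inner_smul_right]
    nlinarith [mul_nonpos_of_nonneg_of_nonpos (le_of_lt (mem_Ioi.1 ht)) hAv]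

/-- Locally uniform (in the parameter `y`) quadratic decrease along a critical direction of
negative curvature. -/
theorem exists_le_add_sq_of_iteratedFDeriv_neg {H G : Type*} [NormedAddCommGroup H]
    [InnerProductSpace ℝ H] [CompleteSpace H] [NormedAddCommGroup G] [NormedSpace ℝ G]
    {f : H → G → ℝ} (hf : ContDiff ℝ 2 (fun z : H × G => f z.1 z.2)) {xh v : H} {yh : G}
    (hQ : iteratedFDeriv ℝ 2 (fun x => f x yh) xh ![v, v] < 0) :
    ∃ η > (0 : ℝ), ∃ c < (0 : ℝ), ∀ t ∈ Icc 0 η, ∀ y, ‖y - yh‖ ≤ η →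
      ⟪v, gradient (fun x => f x y) xh⟫ = 0 → f (xh + t • v) y ≤ f xh y + c * t ^ 2 := by
  set F : H × G → ℝ := fun z => f z.1 z.2 with hF
  have hd : Differentiable ℝ F := hf.differentiable two_ne_zero
  have hf1 : ContDiff ℝ 1 (fderiv ℝ F) := hf.fderiv_right (by norm_num)
  have hd1 : Differentiable ℝ (fderiv ℝ F) := hf1.differentiable one_ne_zero
  have hc2 : Continuous (fderiv ℝ (fderiv ℝ F)) := hf1.continuous_fderiv one_ne_zero
  have hpart : ∀ y x, HasFDerivAt (fun x => f x y)
      ((fderiv ℝ F (x, y)).comp (ContinuousLinearMap.inl ℝ H G)) x := fun y x =>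
    HasFDerivAt.comp (g := F) (f := fun e => (e, y)) x (hd (x, y)).hasFDerivAt
      (hasFDerivAt_prodMk_left x y)
  have hgrad : ∀ y, ⟪v, gradient (fun x => f x y) xh⟫ = fderiv ℝ F (xh, y) (v, 0) := by
    intro y
    rw [real_inner_comm, gradient, InnerProductSpace.toDual_symm_apply, (hpart y xh).fderiv]
    simp
  have hpart2 : iteratedFDeriv ℝ 2 (fun x => f x yh) xh ![v, v]
      = fderiv ℝ (fderiv ℝ F) (xh, yh) (v, 0) (v, 0) := by
    rw [iteratedFDeriv_two_apply]
    have he : fderiv ℝ (fun x => f x yh) = fun x =>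
        (fderiv ℝ F (x, yh)).comp (ContinuousLinearMap.inl ℝ H G) :=
      funext fun x => (hpart yh x).fderiv
    rw [he]
    have h1 : HasFDerivAt (fun x => fderiv ℝ F (x, yh))
        ((fderiv ℝ (fderiv ℝ F) (xh, yh)).comp (ContinuousLinearMap.inl ℝ H G)) xh := by
      refine HasFDerivAt.comp (𝕜 := ℝ) (E := H) (F := H × G) (G := H × G →L[ℝ] ℝ)
        (g := fderiv ℝ F) (g' := fderiv ℝ (fderiv ℝ F) (xh, yh)) (f := fun x => (x, yh))
        (f' := ContinuousLinearMap.inl ℝ H G) xh ?_ (hasFDerivAt_prodMk_left xh yh)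
      exact (hd1 (xh, yh)).hasFDerivAt
    rw [(h1.clm_comp (hasFDerivAt_const (ContinuousLinearMap.inl ℝ H G) xh)).fderiv]
    simp
  set Q := iteratedFDeriv ℝ 2 (fun x => f x yh) xh ![v, v]
  set S : ℝ × G → ℝ := fun p =>
    fderiv ℝ (fderiv ℝ F) (xh + p.1 • v, p.2) (v, 0) (v, 0) with hS
  have hScont : Continuous S := by fun_prop
  have hS0 : S (0, yh) < Q / 2 := by
    have : S (0, yh) = Q := by simp [hS, hpart2]
    linarith
  obtain ⟨ε, hε, hball⟩ := Metric.eventually_nhds_iff.1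
    (hScont.continuousAt.eventually_lt continuousAt_const hS0)
  refine ⟨ε / 2, by positivity, Q / 2 / 2, by linarith, fun t ht y hy hcrit => ?_⟩
  have hline : ∀ s : ℝ, HasDerivAt (fun s : ℝ => (xh + s • v, y)) (v, (0 : G)) s := by
    intro s
    have h : HasDerivAt (fun s : ℝ => xh + s • v) v s := by
      simpa using ((hasDerivAt_id s).smul_const v).const_add xh
    exact h.prodMk (hasDerivAt_const s y)
  have hφ' : ∀ s : ℝ, HasDerivAt (fun s => F (xh + s • v, y))
      (fderiv ℝ F (xh + s • v, y) (v, 0)) s := fun s =>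
    HasFDerivAt.comp_hasDerivAt (l := F) s (hd (xh + s • v, y)).hasFDerivAt (hline s)
  have hφ'' : ∀ s : ℝ, HasDerivAt (fun s => fderiv ℝ F (xh + s • v, y) (v, 0))
      (S (s, y)) s := by
    intro s
    have h : HasDerivAt (fun s : ℝ => fderiv ℝ F (xh + s • v, y))
        (fderiv ℝ (fderiv ℝ F) (xh + s • v, y) (v, 0)) s :=
      HasFDerivAt.comp_hasDerivAt (l := fderiv ℝ F) s
        (hd1 (xh + s • v, y)).hasFDerivAt (hline s)
    simpa [hS] using h.clm_apply (hasDerivAt_const s ((v, 0) : H × G))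
  have h := le_add_sq_of_second_deriv_le (φ := fun s => F (xh + s • v, y))
    (φ' := fun s => fderiv ℝ F (xh + s • v, y) (v, 0)) (φ'' := fun s => S (s, y))
    (η := ε / 2) (c := Q / 2)
    hφ' hφ'' (by simpa [hgrad] using hcrit)
    (fun s hs => (hball (by
      rw [Prod.dist_eq, max_lt_iff, Real.dist_eq, dist_eq_norm, sub_zero, abs_of_nonneg hs.1]
      exact ⟨by linarith [hs.2], by linarith⟩)).le) t ht
  simpa [hF] using h

/-- second-order KKT-type conditions at a local minimax point for polyhedral
constraint sets. -/
theorem stmt_12 (n m p q : ℕ)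
    (A : Fin p → EuclideanSpace ℝ (Fin n)) (b : Fin p → ℝ)
    (C : Fin q → EuclideanSpace ℝ (Fin m)) (d : Fin q → ℝ)
    (f : EuclideanSpace ℝ (Fin n) → EuclideanSpace ℝ (Fin m) → ℝ)
    (hXne : {x : EuclideanSpace ℝ (Fin n) | ∀ i, ⟪A i, x⟫ ≤ b i}.Nonempty)
    (hYne : {y : EuclideanSpace ℝ (Fin m) | ∀ j, ⟪C j, y⟫ ≤ d j}.Nonempty)
    (hf : ContDiff ℝ 2
      (fun z : EuclideanSpace ℝ (Fin n) × EuclideanSpace ℝ (Fin m) => f z.1 z.2))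
    (xh : EuclideanSpace ℝ (Fin n)) (yh : EuclideanSpace ℝ (Fin m))
    (hmm : IsLocalMinimax {x | ∀ i, ⟪A i, x⟫ ≤ b i} {y | ∀ j, ⟪C j, y⟫ ≤ d j} f xh yh) :
    (∀ v ∈ tangentConeSeq {x : EuclideanSpace ℝ (Fin n) | ∀ i, ⟪A i, x⟫ ≤ b i} xh,
      (∃ δ > (0:ℝ), ∀ y' ∈ Metric.closedBall yh δ,
        ⟪v, gradient (fun x => f x y') xh⟫ = 0) →
      0 ≤ iteratedFDeriv ℝ 2 (fun x => f x yh) xh ![v, v]) ∧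
    (∀ w ∈ tangentConeSeq {y : EuclideanSpace ℝ (Fin m) | ∀ j, ⟪C j, y⟫ ≤ d j} yh,
      ⟪w, gradient (fun y => f xh y) yh⟫ = 0 →
      iteratedFDeriv ℝ 2 (fun y => f xh y) yh ![w, w] ≤ 0) := by
  obtain ⟨hxX, hyY, δ₀, hδ₀, τ, hτpos, hτ, hloc⟩ := hmm
  have hymax : ∀ y ∈ {y : EuclideanSpace ℝ (Fin m) | ∀ j, ⟪C j, y⟫ ≤ d j},
      ‖y - yh‖ ≤ δ₀ → f xh y ≤ f xh yh := fun y hy hyδ =>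
    (hloc δ₀ ⟨hδ₀, le_rfl⟩ xh hxX y hy (by simpa using hδ₀.le) hyδ).1
  constructor
  · rintro v hv ⟨δ, hδ, hcrit⟩
    by_contra! hQ
    obtain ⟨η, hη, c, hc, hdecr⟩ := exists_le_add_sq_of_iteratedFDeriv_neg hf hQ
    have hr : 0 < ‖v‖ + 1 := by positivity
    have hscale : Tendsto (fun t : ℝ => t * (‖v‖ + 1)) (𝓝[>] 0) (𝓝[>] 0) := by
      refine tendsto_nhdsWithin_of_tendsto_nhds_of_eventually_within _
        (((continuous_mul_const (‖v‖ + 1)).tendsto' 0 0 (zero_mul _)).mono_left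
          nhdsWithin_le_nhds) ?_
      filter_upwards [self_mem_nhdsWithin] with t ht
      exact mul_pos ht hr
    have hρ : 0 < min η (min δ δ₀) := lt_min hη (lt_min hδ hδ₀)
    have hev := (eventually_add_smul_mem_of_mem_tangentConeSeq hxX hv).and
      ((hscale.eventually (Ioc_mem_nhdsGT hδ₀)).and
      (((hτ.comp hscale).eventually (ge_mem_nhds hρ)).and
      (Ioc_mem_nhdsGT hη)))
    obtain ⟨t, htX, htδ, htτ, ht0, htη⟩ := hev.exists
    have hsup := (hloc _ htδ _ htX yh hyY
      (by
        rw [add_sub_cancel_left, norm_smul, Real.norm_of_nonneg ht0.le]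
        exact mul_le_mul_of_nonneg_left (by linarith) ht0.le)
      (by simpa using htδ.1.le)).2
    have hle : sSup (f (xh + t • v) '' {y' ∈ {y : EuclideanSpace ℝ (Fin m) |
        ∀ j, ⟪C j, y⟫ ≤ d j} | ‖y' - yh‖ ≤ τ (t * (‖v‖ + 1))}) ≤ f xh yh + c * t ^ 2 := by
      refine csSup_le ⟨_, yh, ⟨hyY, by simpa using (hτpos _ htδ.1).le⟩, rfl⟩ ?_
      rintro _ ⟨y, ⟨hyC, hyτ⟩, rfl⟩
      have hyρ : ‖y - yh‖ ≤ min η (min δ δ₀) := hyτ.trans htτ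
      simp only [le_min_iff] at hyρ
      have h1 := hdecr t ⟨ht0.le, htη⟩ y hyρ.1
        (hcrit y (by simpa [dist_eq_norm] using hyρ.2.1))
      linarith [hymax y hyC hyρ.2.2]
    linarith [mul_neg_of_neg_of_pos hc (pow_pos ht0 2)]
  · intro w hw hcrit
    by_contra! hQ
    have hf' : ContDiff ℝ 2 (fun z : EuclideanSpace ℝ (Fin m) × EuclideanSpace ℝ (Fin n) =>
        -f z.2 z.1) := (hf.comp (contDiff_snd.prodMk contDiff_fst)).neg
    obtain ⟨η, hη, c, hc, hdecr⟩ := exists_le_add_sq_of_iteratedFDeriv_neg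
      (f := fun y x => -f x y) (xh := yh) (yh := xh) (v := w) hf' (by
        rw [show (fun y => -f xh y) = -(fun y => f xh y) from rfl, iteratedFDeriv_neg]
        simpa using hQ)
    have hnear : ∀ᶠ t in 𝓝[>] (0 : ℝ), ‖yh + t • w - yh‖ ≤ δ₀ := by
      have hcont : Continuous fun t : ℝ => ‖yh + t • w - yh‖ := by fun_prop
      exact nhdsWithin_le_nhds
        (hcont.continuousAt.eventually (ge_mem_nhds (by simpa using hδ₀)))
    obtain ⟨t, ⟨htY, htδ⟩, ht0, htη⟩ :=
      (((eventually_add_smul_mem_of_mem_tangentConeSeq hyY hw).and hnear).and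
        (Ioc_mem_nhdsGT hη)).exists
    have h1 := hdecr t ⟨ht0.le, htη⟩ xh (by simpa using hη.le) (by
      rw [gradient] at hcrit ⊢
      rw [fderiv_fun_neg, map_neg, inner_neg_right, hcrit, neg_zero])
    linarith [hymax _ htY htδ, mul_neg_of_neg_of_pos hc (pow_pos ht0 2)]
end
end

section
/- Let (x̂,ŷ) be a global minimax point, let f be Lipschitz continuous over X×Y, let Y be compact, and suppose that for every x in some neighborhood of x̂ (intersected with X) the problem max_{y'∈Y} f(x,y') has a unique solution. Then (x̂,ŷ) is a local minimax point. -/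
open Filter Topology Set Metric Bornology RealInnerProductSpace Pointwise

noncomputable section

variable {E : Type*} [NormedAddCommGroup E] [NormedSpace ℝ E]
variable {F : Type*} [NormedAddCommGroup F] [NormedSpace ℝ F]

/-- The largest distance from `a` to a point of `Y` where `g` falls short of `g a` by at most `c`. -/
def nearMaxRadius {α : Type*} [PseudoMetricSpace α] (Y : Set α) (g : α → ℝ) (a : α) (c : ℝ) : ℝ :=
  sSup ((fun y => dist y a) '' {y ∈ Y | g a ≤ g y + c})

theorem dist_le_nearMaxRadius {α : Type*} [PseudoMetricSpace α] {Y : Set α} {g : α → ℝ} {a y : α}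
    {c : ℝ} (hY : IsBounded Y) (hy : y ∈ Y) (hc : g a ≤ g y + c) :
    dist y a ≤ nearMaxRadius Y g a c := by
  obtain ⟨R, hR⟩ := hY.subset_closedBall a
  exact le_csSup ⟨R, by rintro _ ⟨z, hz, rfl⟩; exact hR hz.1⟩ ⟨y, ⟨hy, hc⟩, rfl⟩

theorem nearMaxRadius_nonneg {α : Type*} [PseudoMetricSpace α] (Y : Set α) (g : α → ℝ) (a : α)
    (c : ℝ) : 0 ≤ nearMaxRadius Y g a c :=
  Real.sSup_nonneg (by rintro _ ⟨z, -, rfl⟩; exact dist_nonneg)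

/-- Near-maximizers of a continuous function on a compact set concentrate at a unique maximizer. -/
theorem tendsto_nearMaxRadius {α : Type*} [MetricSpace α] {Y : Set α} {g : α → ℝ} {a : α}
    (hY : IsCompact Y) (hg : ContinuousOn g Y) (ha : ∀ y ∈ Y, y ≠ a → g y < g a) :
    Tendsto (nearMaxRadius Y g a) (𝓝 0) (𝓝 0) := by
  rw [Metric.tendsto_nhds]
  intro η hη
  obtain ⟨r, hr, hgap⟩ : ∃ r > (0 : ℝ), ∀ y ∈ Y, η / 2 ≤ dist y a → g y + r ≤ g a := by
    have hcp : IsCompact (Y ∩ {y | η / 2 ≤ dist y a}) :=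
      hY.inter_right (isClosed_le continuous_const (continuous_id.dist continuous_const))
    rcases (Y ∩ {y | η / 2 ≤ dist y a}).eq_empty_or_nonempty with he | hne
    · refine ⟨1, one_pos, fun y hy hd => ?_⟩
      have : y ∈ Y ∩ {y | η / 2 ≤ dist y a} := ⟨hy, hd⟩
      simp [he] at this
    · obtain ⟨z, ⟨hzY, hzd⟩, hzmax⟩ := hcp.exists_isMaxOn hne (hg.mono inter_subset_left)
      have hza : z ≠ a := by
        rintro rfl
        simp only [mem_ofPred_eq, dist_self] at hzd
        linarith
      refine ⟨g a - g z, sub_pos.2 (ha z hzY hza), fun y hy hd => ?_⟩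
      have : g y ≤ g z := hzmax ⟨hy, hd⟩
      linarith
  filter_upwards [gt_mem_nhds hr] with c hc
  rw [Real.dist_eq, sub_zero, abs_of_nonneg (nearMaxRadius_nonneg Y g a c)]
  refine (Real.sSup_le ?_ (half_pos hη).le).trans_lt (half_lt_self hη)
  rintro _ ⟨y, ⟨hy, hyc⟩, rfl⟩
  by_contra! h
  have := hgap y hy h.le
  linarith

/-- a global minimax point with locally unique inner maximizers is a local
minimax point. -/
theorem stmt_14 (n m : ℕ)
    (X : Set (EuclideanSpace ℝ (Fin n))) (Y : Set (EuclideanSpace ℝ (Fin m)))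
    (f : EuclideanSpace ℝ (Fin n) → EuclideanSpace ℝ (Fin m) → ℝ)
    (hXne : X.Nonempty) (hXcl : IsClosed X) (hXcv : Convex ℝ X)
    (hYne : Y.Nonempty) (hYcl : IsClosed Y) (hYcv : Convex ℝ Y)
    (K : NNReal)
    (hlip : LipschitzOnWith K
      (fun p : EuclideanSpace ℝ (Fin n) × EuclideanSpace ℝ (Fin m) => f p.1 p.2) (X ×ˢ Y))
    (hYcp : IsCompact Y)
    (xh : EuclideanSpace ℝ (Fin n)) (yh : EuclideanSpace ℝ (Fin m))
    (hgm : IsGlobalMinimax X Y f xh yh)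
    (huniq : ∃ ε > (0:ℝ), ∀ x ∈ X, ‖x - xh‖ ≤ ε →
      ∃! y, y ∈ Y ∧ ∀ y' ∈ Y, f x y' ≤ f x y) :
    IsLocalMinimax X Y f xh yh := by
  obtain ⟨hxX, hyY, hmax, hmin⟩ := hgm
  obtain ⟨ε, hε, hu⟩ := huniq
  have hcont : ∀ x ∈ X, ContinuousOn (f x) Y := fun x hx =>
    hlip.continuousOn.comp (continuousOn_const.prodMk continuousOn_id) fun y hy => ⟨hx, hy⟩
  have hstrict : ∀ y ∈ Y, y ≠ yh → f xh y < f xh yh := fun y hy hne => by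
    refine lt_of_le_of_ne (hmax y hy) fun heq => hne ?_
    exact (hu xh hxX (by simpa using hε.le)).unique ⟨hy, by simpa [heq] using hmax⟩ ⟨hyY, hmax⟩
  have hdist : ∀ x ∈ X, ∀ y ∈ Y, |f x y - f xh y| ≤ K * ‖x - xh‖ := fun x hx y hy => by
    have := hlip.dist_le_mul (x, y) ⟨hx, hy⟩ (xh, y) ⟨hxX, hy⟩
    simpa [Real.dist_eq, Prod.dist_eq, dist_eq_norm] using this
  refine ⟨hxX, hyY, ε, hε, fun δ => δ + nearMaxRadius Y (f xh) yh (2 * K * δ),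
    fun δ hδ => add_pos_of_pos_of_nonneg hδ (nearMaxRadius_nonneg _ _ _ _), ?_, ?_⟩
  · have hlin : Tendsto (fun δ : ℝ => 2 * (K : ℝ) * δ) (𝓝 0) (𝓝 0) :=
      Continuous.tendsto' (by fun_prop) _ _ (by simp)
    have hadd := tendsto_id.add ((tendsto_nearMaxRadius hYcp (hcont xh hxX) hstrict).comp hlin)
    rw [add_zero] at hadd
    exact hadd.mono_left nhdsWithin_le_nhds
  · rintro δ ⟨hδ, -⟩ x hx y hy hxδ -
    refine ⟨hmax y hy, ?_⟩
    obtain ⟨z, hzY, hz⟩ := hYcp.exists_isMaxOn hYne (hcont x hx)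
    have hKδ : (K : ℝ) * ‖x - xh‖ ≤ K * δ := by gcongr
    have hz₀ := abs_le.1 ((hdist x hx z hzY).trans hKδ)
    have hy₀ := abs_le.1 ((hdist x hx yh hyY).trans hKδ)
    have hzy : f x yh ≤ f x z := hz hyY
    have hrad : dist z yh ≤ nearMaxRadius Y (f xh) yh (2 * K * δ) :=
      dist_le_nearMaxRadius hYcp.isBounded hzY (by linarith)
    rw [dist_eq_norm] at hrad
    calc f xh yh ≤ sSup (f x '' Y) := hmin x hx
      _ ≤ f x z := csSup_le (hYne.image _) (by rintro _ ⟨w, hw, rfl⟩; exact hz hw)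
      _ ≤ sSup (f x '' {y' ∈ Y | ‖y' - yh‖ ≤ δ + nearMaxRadius Y (f xh) yh (2 * K * δ)}) :=
        le_csSup ⟨f x z, by rintro _ ⟨w, hw, rfl⟩; exact hz hw.1⟩
          (mem_image_of_mem (f x) ⟨hzY, by linarith⟩)
end
end

section
/- Let μ₁ and μ₂ be probability measures on ℝ^{s₁} and ℝ^{s₂} respectively, each with bounded support, and define the GAN objective f(x,y) := ∫ log( 1/(1+exp(⟨y,ξ₁⟩)) ) dμ₁(ξ₁) + ∫ log( 1 − 1/(1+exp(⟨y, W₂(W₁ξ₂+b₁)₊ + b₂⟩)) ) dμ₂(ξ₂), where x = (W₁,W₂,b₁,b₂) with W₁ ∈ ℝ^{s×s₂}, b₁ ∈ ℝ^s, W₂ ∈ ℝ^{s₁×s}, b₂ ∈ ℝ^{s₁}, y ∈ ℝ^{s₁}, and (z)₊ denotes the componentwise positive part max{z,0}. Then f is locally Lipschitz continuous (jointly in (x,y)). -/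
open Filter Topology Set Metric Bornology MeasureTheory

noncomputable section

/-- The two-layer ReLU generator `G(x,ξ₂) = W₂ (W₁ ξ₂ + b₁)₊ + b₂`. -/
def ganG {s s₁ s₂ : ℕ} (W₁ : Fin s → Fin s₂ → ℝ) (W₂ : Fin s₁ → Fin s → ℝ)
    (b₁ : Fin s → ℝ) (b₂ : Fin s₁ → ℝ) (ξ : Fin s₂ → ℝ) : Fin s₁ → ℝ :=
  fun k => (∑ i, W₂ k i * max (∑ j, W₁ i j * ξ j + b₁ i) 0) + b₂ k

/-- The GAN objective
`f(x,y) = ∫ log(1/(1+exp⟪y,ξ₁⟫)) dμ₁ + ∫ log(1 − 1/(1+exp⟪y,G(x,ξ₂)⟫)) dμ₂`,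
where `x = (W₁,W₂,b₁,b₂)`. -/
def ganF {s s₁ s₂ : ℕ} (μ₁ : Measure (Fin s₁ → ℝ)) (μ₂ : Measure (Fin s₂ → ℝ))
    (z : ((Fin s → Fin s₂ → ℝ) × (Fin s₁ → Fin s → ℝ) × (Fin s → ℝ) × (Fin s₁ → ℝ)) ×
      (Fin s₁ → ℝ)) : ℝ :=
  (∫ ξ₁, Real.log (1 / (1 + Real.exp (∑ k, z.2 k * ξ₁ k))) ∂μ₁) +
  ∫ ξ₂, Real.log (1 - 1 / (1 + Real.exp
      (∑ k, z.2 k * ganG z.1.1 z.1.2.1 z.1.2.2.1 z.1.2.2.2 ξ₂ k))) ∂μ₂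

/-- The (topological) support of a measure: points all of whose neighborhoods have
positive measure. -/
def msupport {α : Type*} [TopologicalSpace α] [MeasurableSpace α] (μ : Measure α) : Set α :=
  {x | ∀ U ∈ 𝓝 x, 0 < μ U}

theorem LocallyLipschitz.real_mul {α : Type*} [PseudoEMetricSpace α] {f g : α → ℝ}
    (hf : LocallyLipschitz f) (hg : LocallyLipschitz g) :
    LocallyLipschitz fun x => f x * g x :=
  (ContDiff.locallyLipschitz (𝕂 := ℝ) (contDiff_fst.mul contDiff_snd)).comp (hf.prodMk hg)

theorem LocallyLipschitz.real_sum {α ι : Type*} [PseudoEMetricSpace α] {f : ι → α → ℝ}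
    (t : Finset ι) (hf : ∀ i ∈ t, LocallyLipschitz (f i)) :
    LocallyLipschitz fun x => ∑ i ∈ t, f i x := by
  classical
  induction t using Finset.induction_on with
  | empty => simpa using LocallyLipschitz.const (0 : ℝ)
  | insert i t hi ih =>
    simp only [Finset.sum_insert hi]
    exact (hf i (by simp)).add (ih fun j hj => hf j (by simp [hj]))

/-- On a compact set of second arguments, a jointly locally Lipschitz function is Lipschitz in its
first argument near any given point, with a uniform constant. -/
theorem LocallyLipschitz.exists_lipschitzOnWith_of_isCompact {α β γ : Type*}
    [PseudoEMetricSpace α] [PseudoEMetricSpace β] [PseudoEMetricSpace γ] {F : α × β → γ}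
    (hF : LocallyLipschitz F) {K : Set β} (hK : IsCompact K) (a : α) :
    ∃ C, ∃ U ∈ 𝓝 a, ∀ b ∈ K, LipschitzOnWith C (fun x => F (x, b)) U := by
  refine hK.induction_on (p := fun S => ∃ C, ∃ U ∈ 𝓝 a, ∀ b ∈ S,
    LipschitzOnWith C (fun x => F (x, b)) U) ⟨0, univ, univ_mem, by simp⟩ ?_ ?_ ?_
  · rintro S T hST ⟨C, U, hU, h⟩
    exact ⟨C, U, hU, fun b hb => h b (hST hb)⟩
  · rintro S T ⟨C, U, hU, h⟩ ⟨D, V, hV, h'⟩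
    refine ⟨max C D, U ∩ V, inter_mem hU hV, ?_⟩
    rintro b (hb | hb)
    · exact ((h b hb).mono inter_subset_left).weaken (le_max_left _ _)
    · exact ((h' b hb).mono inter_subset_right).weaken (le_max_right _ _)
  · intro b _
    obtain ⟨C, W, hW, h⟩ := hF (a, b)
    obtain ⟨U, hU, V, hV, hUV⟩ := mem_nhds_prod_iff.1 hW
    refine ⟨V, mem_nhdsWithin_of_mem_nhds hV, C, U, hU, fun b hb => ?_⟩
    simpa [Function.comp_def] using h.comp (LipschitzWith.prodMk_right b).lipschitzOnWith
      (fun x hx => hUV ⟨hx, hb⟩)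

theorem isCompact_msupport {α : Type*} [PseudoMetricSpace α] [ProperSpace α] [MeasurableSpace α]
    {μ : Measure α} (h : IsBounded (msupport μ)) : IsCompact (msupport μ) := by
  have : msupport μ = μ.support := by
    ext x
    exact (μ.mem_support_iff_forall x).symm
  rw [this] at h ⊢
  exact isCompact_of_isClosed_isBounded μ.isClosed_support h

theorem ae_mem_msupport {α : Type*} [TopologicalSpace α] [HereditarilyLindelofSpace α]
    [MeasurableSpace α] (μ : Measure α) : ∀ᵐ x ∂μ, x ∈ msupport μ := by
  filter_upwards [μ.support_mem_ae] with x hx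
  exact (μ.mem_support_iff_forall x).1 hx

/-- Integrating out a parameter that ranges over a compact set preserves local Lipschitz
continuity. -/
theorem LocallyLipschitz.integral {α β : Type*} [PseudoMetricSpace α] [PseudoMetricSpace β]
    [SecondCountableTopology β] [MeasurableSpace β] [OpensMeasurableSpace β] {μ : Measure β}
    [IsFiniteMeasure μ] {F : α × β → ℝ} (hF : LocallyLipschitz F) {K : Set β}
    (hK : IsCompact K) (hμ : ∀ᵐ b ∂μ, b ∈ K) :
    LocallyLipschitz fun a => ∫ b, F (a, b) ∂μ := by
  have hint (a : α) : Integrable (fun b => F (a, b)) μ := by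
    have hc : Continuous fun b => F (a, b) := hF.continuous.comp (by fun_prop)
    obtain ⟨M, hM⟩ := hK.exists_bound_of_continuousOn hc.continuousOn
    exact .of_bound hc.aestronglyMeasurable M (hμ.mono hM)
  intro a
  obtain ⟨C, U, hU, h⟩ := hF.exists_lipschitzOnWith_of_isCompact hK a
  refine ⟨C * (μ univ).toNNReal, U, hU, LipschitzOnWith.of_dist_le_mul fun x hx y hy => ?_⟩
  rw [dist_eq_norm, ← integral_sub (hint x) (hint y)]
  refine (norm_integral_le_of_norm_le_const (C := C * dist x y) ?_).trans_eq ?_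
  · filter_upwards [hμ] with b hb
    simpa only [dist_eq_norm] using (h b hb).dist_le_mul x hx y hy
  · simp only [Measure.real, NNReal.coe_mul, ENNReal.coe_toNNReal_eq_toReal]
    ring

theorem locallyLipschitz_log_one_div_one_add_exp :
    LocallyLipschitz fun t : ℝ => Real.log (1 / (1 + Real.exp t)) := by
  refine ContDiff.locallyLipschitz (𝕂 := ℝ) (ContDiff.log ?_ fun t => by positivity)
  exact contDiff_const.div (contDiff_const.add Real.contDiff_exp) fun t => by positivity

theorem locallyLipschitz_log_one_sub_one_div_one_add_exp :
    LocallyLipschitz fun t : ℝ => Real.log (1 - 1 / (1 + Real.exp t)) := by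
  have h (t : ℝ) : 1 - 1 / (1 + Real.exp t) = Real.exp t / (1 + Real.exp t) := by
    field_simp
    ring
  simp only [h]
  refine ContDiff.locallyLipschitz (𝕂 := ℝ) (ContDiff.log ?_ fun t => by positivity)
  exact Real.contDiff_exp.div (contDiff_const.add Real.contDiff_exp) fun t => by positivity

/-- The generator `ganG` is locally Lipschitz jointly in all weights, biases and the input. -/
theorem locallyLipschitz_ganG {α : Type*} [PseudoEMetricSpace α] {s s₁ s₂ : ℕ}
    {W₁ : α → Fin s → Fin s₂ → ℝ} {W₂ : α → Fin s₁ → Fin s → ℝ} {b₁ : α → Fin s → ℝ}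
    {b₂ : α → Fin s₁ → ℝ} {ξ : α → Fin s₂ → ℝ}
    (hW₁ : ∀ i j, LocallyLipschitz fun a => W₁ a i j)
    (hW₂ : ∀ k i, LocallyLipschitz fun a => W₂ a k i)
    (hb₁ : ∀ i, LocallyLipschitz fun a => b₁ a i) (hb₂ : ∀ k, LocallyLipschitz fun a => b₂ a k)
    (hξ : ∀ j, LocallyLipschitz fun a => ξ a j) (k : Fin s₁) :
    LocallyLipschitz fun a => ganG (W₁ a) (W₂ a) (b₁ a) (b₂ a) (ξ a) k :=
  (LocallyLipschitz.real_sum _ fun i _ => (hW₂ k i).real_mul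
    (((LocallyLipschitz.real_sum _ fun j _ => (hW₁ i j).real_mul (hξ j)).add
      (hb₁ i)).max_const 0)).add (hb₂ k)

/-- The space of pairs `(x, y)` with `x = (W₁, W₂, b₁, b₂)`, the domain of `ganF`. -/
abbrev GanParam (s s₁ s₂ : ℕ) : Type :=
  ((Fin s → Fin s₂ → ℝ) × (Fin s₁ → Fin s → ℝ) × (Fin s → ℝ) × (Fin s₁ → ℝ)) × (Fin s₁ → ℝ)

/-- the GAN objective with ReLU activation is locally Lipschitz continuous
jointly in the parameters. -/
theorem stmt_15 (s s₁ s₂ : ℕ) (μ₁ : Measure (Fin s₁ → ℝ)) (μ₂ : Measure (Fin s₂ → ℝ))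
    [IsProbabilityMeasure μ₁] [IsProbabilityMeasure μ₂]
    (h₁ : IsBounded (msupport μ₁)) (h₂ : IsBounded (msupport μ₂)) :
    LocallyLipschitz (ganF (s := s) (s₁ := s₁) (s₂ := s₂) μ₁ μ₂) := by
  have hreal : LocallyLipschitz fun p : GanParam s s₁ s₂ × (Fin s₁ → ℝ) =>
      Real.log (1 / (1 + Real.exp (∑ k, p.1.2 k * p.2 k))) :=
    locallyLipschitz_log_one_div_one_add_exp.comp
      (ContDiff.locallyLipschitz (𝕂 := ℝ) (by fun_prop))
  have hfake : LocallyLipschitz fun p : GanParam s s₁ s₂ × (Fin s₂ → ℝ) =>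
      Real.log (1 - 1 / (1 + Real.exp
        (∑ k, p.1.2 k * ganG p.1.1.1 p.1.1.2.1 p.1.1.2.2.1 p.1.1.2.2.2 p.2 k))) := by
    refine locallyLipschitz_log_one_sub_one_div_one_add_exp.comp
      (LocallyLipschitz.real_sum _ fun k _ => LocallyLipschitz.real_mul
        (ContDiff.locallyLipschitz (𝕂 := ℝ) (by fun_prop))
        (locallyLipschitz_ganG ?_ ?_ ?_ ?_ ?_ k)) <;> intros <;>
      exact ContDiff.locallyLipschitz (𝕂 := ℝ) (by fun_prop)
  exact (hreal.integral (isCompact_msupport h₁) (ae_mem_msupport μ₁)).add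
    (hfake.integral (isCompact_msupport h₂) (ae_mem_msupport μ₂))
end
end

section
/- Let f(x,y) = −x² + 5xy − y² on X×Y with X = Y = [−1,1]. Then (0,0) is both a global minimax point and a local minimax point of min_{x∈[−1,1]} max_{y∈[−1,1]} f(x,y), but (0,0) is not a local saddle point (and hence not a saddle point): for every δ ∈ (0,1] there exist x,y ∈ [−1,1] with |x| ≤ δ and |y| ≤ δ such that the saddle inequalities f(0,y) ≤ f(0,0) ≤ f(x,0) fail. -/
open Filter Topology Set Metric Bornology RealInnerProductSpace Pointwise

noncomputable section

variable {E : Type*} [NormedAddCommGroup E] [NormedSpace ℝ E]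
variable {F : Type*} [NormedAddCommGroup F] [NormedSpace ℝ F]

/-- The objective of Example 1. -/
def f17 (x y : ℝ) : ℝ := -x ^ 2 + 5 * x * y - y ^ 2

theorem zero_le_sSup_f17_image {x : ℝ} {S : Set ℝ} (hx : x ∈ S) :
    0 ≤ sSup (f17 x '' S) := by
  have hbdd : BddAbove (f17 x '' S) := by
    refine ⟨21 / 4 * x ^ 2, ?_⟩
    rintro _ ⟨y, -, rfl⟩
    unfold f17
    nlinarith [sq_nonneg (y - 5 / 2 * x)]
  refine le_trans ?_ (le_csSup hbdd (mem_image_of_mem _ hx))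
  unfold f17
  nlinarith [sq_nonneg x]

theorem f17_zero_left_le (y : ℝ) : f17 0 y ≤ f17 0 0 := by
  simp [f17, sq_nonneg]

/-- `(0,0)` is a global and local minimax point of
`min_{x∈[-1,1]} max_{y∈[-1,1]} (-x² + 5xy - y²)` but not a (local) saddle point. -/
theorem stmt_17 :
    IsGlobalMinimax (Icc (-1:ℝ) 1) (Icc (-1:ℝ) 1) f17 0 0 ∧
    IsLocalMinimax (Icc (-1:ℝ) 1) (Icc (-1:ℝ) 1) f17 0 0 ∧
    ∀ δ ∈ Ioc (0:ℝ) 1, ∃ x ∈ Icc (-1:ℝ) 1, ∃ y ∈ Icc (-1:ℝ) 1,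
      |x| ≤ δ ∧ |y| ≤ δ ∧ ¬(f17 0 y ≤ f17 0 0 ∧ f17 0 0 ≤ f17 x 0) := by
  have h0 : (0 : ℝ) ∈ Icc (-1 : ℝ) 1 := by norm_num
  have hf0 : f17 0 0 = 0 := by simp [f17]
  refine ⟨⟨h0, h0, fun y _ => f17_zero_left_le y, fun x hx => ?_⟩,
    ⟨h0, h0, 1, one_pos, id, fun _ h => h, tendsto_id.mono_left nhdsWithin_le_nhds,
      fun δ _ x hx y _ hxδ _ => ⟨f17_zero_left_le y, ?_⟩⟩,
    fun δ hδ => ⟨δ, ⟨by linarith [hδ.1], hδ.2⟩, 0, h0, (abs_of_pos hδ.1).le, by simpa using hδ.1.le,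
      fun h => ?_⟩⟩
  · rw [hf0]
    exact zero_le_sSup_f17_image hx
  · rw [hf0]
    exact zero_le_sSup_f17_image ⟨hx, hxδ⟩
  · have hneg := h.2
    simp only [f17] at hneg
    nlinarith [pow_pos hδ.1 2]
end
end

section
/- Let f(x,y) = xy − cos(y) on X×Y with X = [−1,1] and Y = [−5,5]. Then (0,π) and (0,−π) are global minimax points of min_{x∈[−1,1]} max_{y∈[−5,5]} f(x,y); neither of them is a first-order stationary point (i.e., the conditions 0 ∈ ∇_x f(x̂,ŷ) + N_X(x̂) and 0 ∈ −∇_y f(x̂,ŷ) + N_Y(ŷ) fail at both points); and the problem has no local minimax point at all. -/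
open Filter Topology Set Metric Bornology RealInnerProductSpace Pointwise

noncomputable section

variable {E : Type*} [NormedAddCommGroup E] [NormedSpace ℝ E]
variable {F : Type*} [NormedAddCommGroup F] [NormedSpace ℝ F]

open Real

/-- The objective of Example 5: `f(x,y) = xy − cos y`. -/
def f18 (x y : ℝ) : ℝ := x * y - Real.cos y

lemma f18_neg_neg (x y : ℝ) : f18 (-x) (-y) = f18 x y := by
  simp [f18]

lemma bddAbove_f18_image (x : ℝ) (S : Set ℝ) (hS : S ⊆ Icc (-5 : ℝ) 5) :
    BddAbove (f18 x '' S) := by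
  have hc : Continuous (f18 x) := by
    unfold f18
    fun_prop
  exact (isCompact_Icc.image hc).bddAbove.mono (image_mono hS)

lemma isGlobalMinimax_zero_of_cos_eq_neg_one {p : ℝ} (hp : p ∈ Icc (-5 : ℝ) 5)
    (hcos : Real.cos p = -1) :
    IsGlobalMinimax (Icc (-1 : ℝ) 1) (Icc (-5 : ℝ) 5) f18 0 p := by
  refine ⟨by simp, hp, fun y _ => ?_, fun x _ => ?_⟩
  · simp only [f18, hcos]
    linarith [Real.neg_one_le_cos y]
  · rcases le_total 0 (x * p) with h | h
    · refine le_csSup_of_le (bddAbove_f18_image x _ Subset.rfl) (mem_image_of_mem _ hp) ?_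
      simp only [f18]
      linarith
    · have hp' : -p ∈ Icc (-5 : ℝ) 5 := ⟨by linarith [hp.2], by linarith [hp.1]⟩
      refine le_csSup_of_le (bddAbove_f18_image x _ Subset.rfl) (mem_image_of_mem _ hp') ?_
      simp only [f18, Real.cos_neg]
      linarith

lemma deriv_f18_left (x y : ℝ) : deriv (fun x => f18 x y) x = y := by
  simp [f18]

lemma normalCone_Icc_zero {v : ℝ} (hv : v ∈ normalCone (Icc (-1 : ℝ) 1) 0) : v = 0 := by
  have h1 := hv 1 (by simp)
  have h2 := hv (-1) (by simp)
  simp at h1 h2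
  linarith

lemma zero_notMem_deriv_add_normalCone {p : ℝ} (hp : p ≠ 0) :
    (0 : ℝ) ∉ ({deriv (fun x => f18 x p) 0} : Set ℝ) + normalCone (Icc (-1 : ℝ) 1) 0 := by
  rw [deriv_f18_left]
  rintro ⟨a, rfl, v, hv, h⟩
  simp only [normalCone_Icc_zero hv, add_zero] at h
  exact hp h

/-- A consequence of local minimaxity, free of suprema and of the function `τ`. -/
def WeakLocalMinimax (xh yh : ℝ) : Prop :=
  xh ∈ Icc (-1 : ℝ) 1 ∧ yh ∈ Icc (-5 : ℝ) 5 ∧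
    (∃ d > 0, ∀ y ∈ Icc (-5 : ℝ) 5, |y - yh| ≤ d → f18 xh y ≤ f18 xh yh) ∧
    ∀ r > 0, ∃ d > 0, d < r ∧ ∀ x ∈ Icc (-1 : ℝ) 1, |x - xh| ≤ d →
      ∀ c, (∀ y ∈ Icc (-5 : ℝ) 5, |y - yh| ≤ r → f18 x y ≤ c) → f18 xh yh ≤ c

lemma IsLocalMinimax.weakLocalMinimax {xh yh : ℝ}
    (h : IsLocalMinimax (Icc (-1 : ℝ) 1) (Icc (-5 : ℝ) 5) f18 xh yh) :
    WeakLocalMinimax xh yh := by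
  obtain ⟨hx, hy, d, hd, τ, hτ, hlim, H⟩ := h
  refine ⟨hx, hy, ⟨d, hd, fun y hyY hyd => ?_⟩, fun r hr => ?_⟩
  · exact (H d ⟨hd, le_rfl⟩ xh hx y hyY (by simpa using hd.le) hyd).1
  · have h1 : ∀ᶠ t in 𝓝[>] (0 : ℝ), τ t < r := hlim.eventually_lt_const hr
    have h2 : ∀ᶠ t in 𝓝[>] (0 : ℝ), t ∈ Ioo 0 (min d r) :=
      Ioo_mem_nhdsGT (lt_min hd hr)
    obtain ⟨t, ht1, ht2⟩ := (h1.and h2).exists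
    refine ⟨t, ht2.1, ht2.2.trans_le (min_le_right _ _), fun x hxX hxt c hc => ?_⟩
    refine (H t ⟨ht2.1, (ht2.2.trans_le (min_le_left _ _)).le⟩ x hxX yh hy hxt
      (by simpa using ht2.1.le)).2.trans (csSup_le ?_ ?_)
    · exact ⟨_, mem_image_of_mem _ ⟨hy, by simpa using (hτ t ht2.1).le⟩⟩
    · rintro _ ⟨y, ⟨hyY, hyt⟩, rfl⟩
      exact hc y hyY (hyt.trans ht1.le)

lemma neg_mem_Icc_neg {a z : ℝ} (hz : z ∈ Icc (-a) a) : -z ∈ Icc (-a) a :=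
  ⟨by linarith [hz.2], by linarith [hz.1]⟩

lemma WeakLocalMinimax.neg {xh yh : ℝ} (h : WeakLocalMinimax xh yh) :
    WeakLocalMinimax (-xh) (-yh) := by
  obtain ⟨hx, hy, ⟨d, hd, hmax⟩, H⟩ := h
  have habs : ∀ a b : ℝ, |-a - b| = |a - -b| := fun a b => by
    rw [← abs_neg]
    congr 1
    ring
  refine ⟨neg_mem_Icc_neg hx, neg_mem_Icc_neg hy, ⟨d, hd, fun y hyY hyd => ?_⟩,
    fun r hr => ?_⟩
  · have := hmax (-y) (neg_mem_Icc_neg hyY) (by rwa [habs])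
    rwa [← f18_neg_neg, neg_neg, ← f18_neg_neg xh yh] at this
  · obtain ⟨t, ht, htr, ht'⟩ := H r hr
    refine ⟨t, ht, htr, fun x hxX hxt c hc => ?_⟩
    rw [f18_neg_neg]
    refine ht' (-x) (neg_mem_Icc_neg hxX) (by rwa [habs]) c fun y hyY hyr => ?_
    rw [← f18_neg_neg, neg_neg]
    exact hc (-y) (neg_mem_Icc_neg hyY) (by rwa [habs, neg_neg])

lemma f18_neg_one_lt_sub {y t : ℝ} (ht : 0 < t) : f18 (-1) y < f18 (-1) (y - t) := by
  have h := Real.cos_sub_cos (y - t) y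
  have h1 : |Real.sin (((y - t) + y) / 2)| ≤ 1 := Real.abs_sin_le_one _
  have h2 : |Real.sin (((y - t) - y) / 2)| < t / 2 := by
    have e : ((y - t) - y) / 2 = -(t / 2) := by ring
    have := Real.abs_sin_lt_abs (x := -(t / 2)) (by linarith)
    rwa [abs_neg, abs_of_pos (by linarith : 0 < t / 2), ← e] at this
  have h3 := mul_le_of_le_one_left (abs_nonneg (Real.sin (((y - t) - y) / 2))) h1
  rw [← abs_mul] at h3
  have h4 := neg_abs_le (Real.sin (((y - t) + y) / 2) * Real.sin (((y - t) - y) / 2))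
  simp only [f18]
  linarith

lemma WeakLocalMinimax.nonpos {xh yh : ℝ} (h : WeakLocalMinimax xh yh) : yh ≤ 0 := by
  obtain ⟨hx, hy, ⟨d, hd, hmax⟩, H⟩ := h
  by_contra! hpos
  rcases hx.1.eq_or_lt with rfl | hlt
  · have ht : 0 < min d yh := lt_min hd hpos
    refine (f18_neg_one_lt_sub (y := yh) ht).not_ge (hmax _ ⟨?_, ?_⟩ ?_)
    · linarith [min_le_right d yh]
    · linarith [hy.2]
    · rw [sub_sub_cancel_left, abs_neg, abs_of_pos ht]
      exact min_le_left _ _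
  · obtain ⟨t, ht, htr, ht'⟩ :=
      H (min (min d (yh / 2)) (xh + 1)) (lt_min (lt_min hd (by linarith)) (by linarith))
    have hx1 : t < xh + 1 := htr.trans_le (min_le_right _ _)
    have key := ht' (xh - t) ⟨by linarith, by linarith [hx.2]⟩
      (by rw [sub_sub_cancel_left, abs_neg, abs_of_pos ht])
      (f18 xh yh - t * (yh / 2)) fun y hyY hyr => ?_
    · nlinarith [mul_pos ht hpos]
    · have hyd : |y - yh| ≤ d := hyr.trans ((min_le_left _ _).trans (min_le_left _ _))
      have hy2 : |y - yh| ≤ yh / 2 := hyr.trans ((min_le_left _ _).trans (min_le_right _ _))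
      have hm := hmax y hyY hyd
      have hyl : yh / 2 ≤ y := by linarith [(abs_le.1 hy2).1]
      have e : f18 (xh - t) y = f18 xh y - t * y := by
        simp only [f18]
        ring
      rw [e]
      linarith [mul_le_mul_of_nonneg_left hyl ht.le]

lemma WeakLocalMinimax.ne_zero {xh yh : ℝ} (h : WeakLocalMinimax xh yh) : yh ≠ 0 := by
  rintro rfl
  obtain ⟨_, _, ⟨d, hd, hmax⟩, _⟩ := h
  have ht : 0 < min d 1 := lt_min hd one_pos
  have h1 : min d 1 ≤ 1 := min_le_right _ _
  have hp := hmax (min d 1) ⟨by linarith, by linarith⟩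
    (by rw [sub_zero, abs_of_pos ht]; exact min_le_left _ _)
  have hn := hmax (-min d 1) ⟨by linarith, by linarith⟩
    (by rw [sub_zero, abs_neg, abs_of_pos ht]; exact min_le_left _ _)
  have hcos : Real.cos (min d 1) < 1 := by
    simpa using
      Real.cos_lt_cos_of_nonneg_of_le_pi le_rfl (by linarith [Real.pi_gt_three]) ht
  simp only [f18, Real.cos_neg, Real.cos_zero] at hp hn
  linarith

/-- `(0,π)` and `(0,−π)` are global minimax points of
`min_{x∈[-1,1]} max_{y∈[-5,5]} (xy − cos y)`, neither is a first-order stationary point,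
and the problem has no local minimax point. -/
theorem stmt_18 :
    IsGlobalMinimax (Icc (-1:ℝ) 1) (Icc (-5:ℝ) 5) f18 0 π ∧
    IsGlobalMinimax (Icc (-1:ℝ) 1) (Icc (-5:ℝ) 5) f18 0 (-π) ∧
    ¬(((0:ℝ) ∈ ({deriv (fun x => f18 x π) 0} : Set ℝ) + normalCone (Icc (-1:ℝ) 1) 0) ∧
      ((0:ℝ) ∈ ({-deriv (fun y => f18 0 y) π} : Set ℝ) + normalCone (Icc (-5:ℝ) 5) π)) ∧
    ¬(((0:ℝ) ∈ ({deriv (fun x => f18 x (-π)) 0} : Set ℝ) + normalCone (Icc (-1:ℝ) 1) 0) ∧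
      ((0:ℝ) ∈ ({-deriv (fun y => f18 0 y) (-π)} : Set ℝ) + normalCone (Icc (-5:ℝ) 5) (-π))) ∧
    ¬∃ xh yh, IsLocalMinimax (Icc (-1:ℝ) 1) (Icc (-5:ℝ) 5) f18 xh yh := by
  have hπ : π ∈ Icc (-5 : ℝ) 5 :=
    ⟨by linarith [Real.pi_pos], by linarith [Real.pi_lt_four]⟩
  refine ⟨isGlobalMinimax_zero_of_cos_eq_neg_one hπ Real.cos_pi,
    isGlobalMinimax_zero_of_cos_eq_neg_one (neg_mem_Icc_neg hπ) (by simp),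
    fun h => zero_notMem_deriv_add_normalCone Real.pi_ne_zero h.1,
    fun h => zero_notMem_deriv_add_normalCone (neg_ne_zero.2 Real.pi_ne_zero) h.1, ?_⟩
  rintro ⟨xh, yh, h⟩
  have hw := h.weakLocalMinimax
  exact hw.ne_zero (le_antisymm hw.nonpos (neg_nonpos.1 hw.neg.nonpos))
end
end
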